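/- arXiv:2011.04998 — 4 statements merged into one kernel-verified Lean document; each statement's English description precedes it below -/
import Mathlib

section
/- There exists m₀ ∈ ℕ such that the following holds for all m ≥ m₀. Let X be a set, H a nonempty finite set of base learners h : X → [−1,1], f ∈ C(H) a voting classifier with associated distribution Q = Q(f) on H, S ∈ (X × {−1,1})^m a fixed sample, and θ a margin with 1/m ≤ θ ≤ 1. Let N be any integer with N ≥ lg(16m) · max{ 256·θ^{−1}·( E_{(x,y)∼S, h∼Q}[ Δ(x,h)^{lg(16m)} ] )^{1/lg(16m)}, 100/θ, 128e·θ^{−2}·( E_{(x,y)∼S}[ (E_{h∼Q}[Δ(x,h)²])^{lg(16m)/2} ] )^{2/lg(16m)} }. Draw h_1,…,h_N i.i.d. from Q and set g := (1/N)·Σ_{j=1}^N h_j. Then Pr_{(x,y)∼S, (h_1,…,h_N)∼Q^N}[ |f(x) − g(x)| > 49θ/100 ] ≤ 1/m². -/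
open Finset

/-- The voting classifier `f = ∑_{h ∈ H} α_h · h`. -/
noncomputable def vote {X : Type*} (H : Finset (X → ℝ)) (α : (X → ℝ) → ℝ) : X → ℝ :=
  fun x => ∑ h ∈ H, α h * h x

section ProductWeights

variable {ι : Type*} [Fintype ι] {w z : ι → ℝ} {N : ℕ}

/-- The marginal of a product weight on one coordinate. -/
lemma sum_prod_mul_apply (hw1 : ∑ a, w a = 1) (φ : ι → ℝ) (j₀ : Fin N) :
    ∑ a : Fin N → ι, (∏ j, w (a j)) * φ (a j₀) = ∑ b, w b * φ b := by
  classical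
  have h := Finset.prod_univ_sum (fun _ : Fin N => (Finset.univ : Finset ι))
    (fun j b => w b * (if j = j₀ then φ b else 1))
  rw [Fintype.piFinset_univ] at h
  calc ∑ a : Fin N → ι, (∏ j, w (a j)) * φ (a j₀)
      = ∑ a : Fin N → ι, ∏ j, w (a j) * (if j = j₀ then φ (a j) else 1) := by
        refine Finset.sum_congr rfl fun a _ => ?_
        rw [Finset.prod_mul_distrib, Finset.prod_ite_eq' Finset.univ j₀]
        simp
    _ = ∏ j : Fin N, ∑ b, w b * (if j = j₀ then φ b else 1) := h.symm
    _ = ∏ j : Fin N, (if j = j₀ then ∑ b, w b * φ b else 1) := by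
        refine Finset.prod_congr rfl fun j _ => ?_
        split_ifs <;> simp [hw1]
    _ = ∑ b, w b * φ b := by
        rw [Finset.prod_ite_eq' Finset.univ j₀]
        simp

/-- Quadratic upper bound for the exponential below a level `L`. -/
lemma exp_le_one_add_add_sq_mul_exp {u L : ℝ} (hL : 0 < L) (hu : u ≤ L) :
    Real.exp u ≤ 1 + u + (u / L) ^ 2 * Real.exp L := by
  rcases le_total 0 u with h0 | h0
  · have hexp (x : ℝ) : HasSum (fun n : ℕ => x ^ n / n.factorial) (Real.exp x) := by
      rw [Real.exp_eq_exp_ℝ]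
      exact NormedSpace.expSeries_div_hasSum_exp x
    have h1 := (hasSum_nat_add_iff' 2).mpr (hexp u)
    have h2 := ((hasSum_nat_add_iff' 2).mpr (hexp L)).mul_left ((u / L) ^ 2)
    have h3 := hasSum_le (fun n => ?_) h1 h2
    · simp [Finset.sum_range_succ] at h3
      nlinarith [sq_nonneg (u / L)]
    · rw [div_pow, ← mul_div_assoc]
      refine div_le_div_of_nonneg_right ?_ (by positivity)
      rw [div_mul_eq_mul_div, le_div_iff₀ (by positivity), pow_add u, pow_add L]
      have := pow_le_pow_left₀ h0 hu n
      have h5 : 0 ≤ u ^ 2 * L ^ 2 := by positivity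
      nlinarith [mul_le_mul_of_nonneg_right this h5]
  · have h1 : 1 / 2 ≤ Real.exp L / L ^ 2 := by
      rw [le_div_iff₀ (by positivity)]
      nlinarith [Real.quadratic_le_exp_of_nonneg hL.le]
    have h2 : Real.exp u ≤ 1 + u + u ^ 2 / 2 := by
      have hq := Real.quadratic_le_exp_of_nonneg (neg_nonneg.mpr h0)
      have hpos : 0 < 1 + -u + (-u) ^ 2 / 2 := by nlinarith [sq_nonneg u]
      have hinv : Real.exp u = (Real.exp (-u))⁻¹ := by rw [Real.exp_neg, inv_inv]
      rw [hinv, inv_le_iff_one_le_mul₀ (Real.exp_pos _)]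
      nlinarith [sq_nonneg u, sq_nonneg (u ^ 2), sq_nonneg (u + 1),
        mul_le_mul_of_nonneg_left hq (show 0 ≤ 1 + u + u ^ 2 / 2 by nlinarith [sq_nonneg (u + 1)])]
    have h3 : (u / L) ^ 2 * Real.exp L = u ^ 2 * (Real.exp L / L ^ 2) := by
      field_simp
    rw [h3]
    nlinarith [mul_le_mul_of_nonneg_left h1 (sq_nonneg u)]

/-- Chernoff bound for the upper tail of a centred i.i.d. sum on the event that no summand
exceeds `y`. -/
lemma truncated_chernoff (hw : ∀ a, 0 ≤ w a) (hw1 : ∑ a, w a = 1) (hz : ∑ a, w a * z a = 0)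
    {t y r : ℝ} (hy : 0 < y) (hr : 0 < r) :
    ∑ a : Fin N → ι, (∏ j, w (a j)) *
        (if t < ∑ j, z (a j) ∧ ∀ j, z (a j) ≤ y then (1 : ℝ) else 0) ≤
      Real.exp (-(r * t) + N * ((∑ a, w a * z a ^ 2) * Real.exp (r * y) / y ^ 2)) := by
  set s := ∑ a, w a * z a ^ 2
  set φ : ι → ℝ := fun b => if z b ≤ y then Real.exp (r * z b) else 0 with hφ
  have hφ0 (b) : 0 ≤ φ b := by simp only [hφ]; split_ifs <;> positivity
  have hpt (a : Fin N → ι) : (if t < ∑ j, z (a j) ∧ ∀ j, z (a j) ≤ y then (1 : ℝ) else 0) ≤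
      Real.exp (-(r * t)) * ∏ j, φ (a j) := by
    split_ifs with h
    · have : ∏ j, φ (a j) = Real.exp (r * ∑ j, z (a j)) := by
        rw [Finset.mul_sum, Real.exp_sum]
        exact Finset.prod_congr rfl fun j _ => if_pos (h.2 j)
      rw [this, ← Real.exp_add]
      exact Real.one_le_exp (by nlinarith [h.1])
    · exact mul_nonneg (Real.exp_pos _).le (Finset.prod_nonneg fun j _ => hφ0 _)
  have hmgf : ∑ b, w b * φ b ≤ 1 + s * Real.exp (r * y) / y ^ 2 := by
    have hb (b) : w b * φ b ≤
        w b + r * (w b * z b) + (w b * z b ^ 2) * (Real.exp (r * y) / y ^ 2) := by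
      have hle : φ b ≤ 1 + r * z b + z b ^ 2 * (Real.exp (r * y) / y ^ 2) := by
        simp only [hφ]
        split_ifs with h
        · have := exp_le_one_add_add_sq_mul_exp (mul_pos hr hy)
            (mul_le_mul_of_nonneg_left h hr.le)
          rw [mul_div_mul_left _ _ hr.ne', div_pow, div_mul_eq_mul_div] at this
          rwa [← mul_div_assoc]
        · push Not at h
          have : 0 < r * z b := mul_pos hr (hy.trans h)
          positivity
      nlinarith [mul_le_mul_of_nonneg_left hle (hw b)]
    refine (Finset.sum_le_sum fun b _ => hb b).trans_eq ?_
    rw [Finset.sum_add_distrib, Finset.sum_add_distrib, ← Finset.mul_sum, ← Finset.sum_mul,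
      hw1, hz]
    ring
  calc _ ≤ ∑ a : Fin N → ι, (∏ j, w (a j)) * (Real.exp (-(r * t)) * ∏ j, φ (a j)) :=
        Finset.sum_le_sum fun a _ =>
          mul_le_mul_of_nonneg_left (hpt a) (Finset.prod_nonneg fun j _ => hw _)
    _ = Real.exp (-(r * t)) * (∑ b, w b * φ b) ^ N := by
        rw [Fintype.sum_pow, Finset.mul_sum]
        refine Finset.sum_congr rfl fun a _ => ?_
        rw [Finset.prod_mul_distrib]
        ring
    _ ≤ Real.exp (-(r * t)) * Real.exp (s * Real.exp (r * y) / y ^ 2) ^ N := by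
        have h0 : 0 ≤ ∑ b, w b * φ b := Finset.sum_nonneg fun b _ => mul_nonneg (hw b) (hφ0 b)
        gcongr
        exact hmgf.trans (by linarith [Real.add_one_le_exp (s * Real.exp (r * y) / y ^ 2)])
    _ = _ := by rw [← Real.exp_nat_mul, ← Real.exp_add]

/-- Bennett-type bound for the upper tail of a centred i.i.d. sum on the event that no summand
exceeds `y`. -/
lemma truncated_bennett (hw : ∀ a, 0 ≤ w a) (hw1 : ∑ a, w a = 1) (hz : ∑ a, w a * z a = 0)
    {t y q : ℝ} (hy : 0 < y) (hq : 0 < q) (hqt : q * y ≤ t) :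
    ∑ a : Fin N → ι, (∏ j, w (a j)) *
        (if t < ∑ j, z (a j) ∧ ∀ j, z (a j) ≤ y then (1 : ℝ) else 0) ≤
      (Real.exp 1 * (N * ∑ a, w a * z a ^ 2) / (t * y)) ^ q := by
  have ht : 0 < t := (mul_pos hq hy).trans_le hqt
  have hs : 0 ≤ ∑ a, w a * z a ^ 2 :=
    Finset.sum_nonneg fun a _ => mul_nonneg (hw a) (sq_nonneg _)
  have hch (r : ℝ) (hr : 0 < r) := truncated_chernoff (N := N) hw hw1 hz (t := t) hy hr
  set P := ∑ a : Fin N → ι, (∏ j, w (a j)) *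
        (if t < ∑ j, z (a j) ∧ ∀ j, z (a j) ≤ y then (1 : ℝ) else 0)
  have hP1 : P ≤ 1 := by
    calc P ≤ ∑ a : Fin N → ι, ∏ j, w (a j) := by
          refine Finset.sum_le_sum fun a _ => ?_
          have := Finset.prod_nonneg fun (j : Fin N) (_ : j ∈ Finset.univ) => hw (a j)
          split_ifs <;> simp [this]
      _ = 1 := by rw [← Fintype.sum_pow, hw1, one_pow]
  set s := ∑ a, w a * z a ^ 2
  rcases (mul_nonneg (Nat.cast_nonneg N) hs : 0 ≤ (N : ℝ) * s).eq_or_lt' with h0 | h0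
  · rw [h0, mul_zero, zero_div, Real.zero_rpow hq.ne']
    have hlim : Filter.Tendsto (fun r : ℝ => Real.exp (-(r * t))) Filter.atTop (nhds 0) :=
      Real.tendsto_exp_neg_atTop_nhds_zero.comp (Filter.tendsto_id.atTop_mul_const ht)
    refine ge_of_tendsto hlim ?_
    filter_upwards [Filter.eventually_gt_atTop 0] with r hr
    refine (hch r hr).trans_eq ?_
    rw [mul_div_assoc, ← mul_assoc, h0, zero_mul, add_zero]
  · set V := (N : ℝ) * s
    rcases le_total 1 (Real.exp 1 * V / (t * y)) with h1 | h1
    · exact hP1.trans (Real.one_le_rpow h1 hq.le)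
    · have hpos : 0 < Real.exp 1 * V / (t * y) := by positivity
      have hlog : Real.log (Real.exp 1 * V / (t * y)) = 1 - Real.log (t * y / V) := by
        rw [Real.log_div (by positivity) (by positivity), Real.log_mul (by positivity) h0.ne',
          Real.log_exp, Real.log_div (by positivity) h0.ne']
        ring
      set L := Real.log (t * y / V) with hL
      have hL1 : 1 ≤ L := by
        have := Real.log_nonpos hpos.le h1
        linarith
      have hexpL : Real.exp L = t * y / V := Real.exp_log (by positivity)
      refine (hch (L / y) (by positivity)).trans ?_
      rw [Real.rpow_def_of_pos hpos, hlog, div_mul_cancel₀ _ hy.ne', hexpL]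
      refine Real.exp_le_exp.mpr ?_
      have e1 : (N : ℝ) * (s * (t * y / V) / y ^ 2) = t / y := by
        have : (N : ℝ) * (s * (t * y / V) / y ^ 2) = V * (t * y / V) / y ^ 2 := by
          simp only [V]; ring
        rw [this]
        field_simp
      have e2 : L / y * t = L * (t / y) := by ring
      have e3 : q ≤ t / y := (le_div_iff₀ hy).mpr hqt
      rw [e1, e2]
      nlinarith

/-- Fuk–Nagaev-type bound for the two-sided tail of a centred i.i.d. sum. -/
lemma fuk_nagaev (hw : ∀ a, 0 ≤ w a) (hw1 : ∑ a, w a = 1) (hz : ∑ a, w a * z a = 0)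
    {t y q : ℝ} (hy : 0 < y) (hq : 0 < q) (hqt : q * y ≤ t) :
    ∑ a : Fin N → ι, (∏ j, w (a j)) * (if t < |∑ j, z (a j)| then (1 : ℝ) else 0) ≤
      N * (∑ a, w a * (if y < |z a| then (1 : ℝ) else 0)) +
        2 * (Real.exp 1 * (N * ∑ a, w a * z a ^ 2) / (t * y)) ^ q := by
  have hup := truncated_bennett (N := N) hw hw1 hz hy hq hqt
  have hdn := truncated_bennett (N := N) (z := fun a => -z a) hw hw1
    (by simp [hz]) hy hq hqt
  simp only [neg_sq] at hdn
  have hun : ∑ a : Fin N → ι, (∏ j, w (a j)) * ∑ j, (if y < |z (a j)| then (1 : ℝ) else 0) =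
      N * (∑ a, w a * (if y < |z a| then (1 : ℝ) else 0)) := by
    simp_rw [Finset.mul_sum (s := (Finset.univ : Finset (Fin N)))]
    rw [Finset.sum_comm]
    simp_rw [sum_prod_mul_apply hw1 (fun b => if y < |z b| then (1 : ℝ) else 0)]
    simp
  rw [two_mul, ← hun]
  refine le_trans ?_ (add_le_add_right (add_le_add hup hdn) _)
  rw [← Finset.sum_add_distrib, ← Finset.sum_add_distrib]
  refine Finset.sum_le_sum fun a _ => ?_
  rw [← mul_add, ← mul_add]
  refine mul_le_mul_of_nonneg_left ?_ (Finset.prod_nonneg fun j _ => hw _)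
  have hn : ∀ j, (0 : ℝ) ≤ if y < |z (a j)| then (1 : ℝ) else 0 := fun j => by
    split_ifs <;> norm_num
  have hn' : (0 : ℝ) ≤ ∑ j, if y < |z (a j)| then (1 : ℝ) else 0 :=
    Finset.sum_nonneg fun j _ => hn j
  by_cases hbig : ∃ j, y < |z (a j)|
  · obtain ⟨j, hj⟩ := hbig
    have h1 := Finset.single_le_sum (fun j _ => hn j) (Finset.mem_univ j)
    rw [if_pos hj] at h1
    split_ifs <;> linarith
  · push Not at hbig
    have ha : ∀ j, z (a j) ≤ y := fun j => (le_abs_self _).trans (hbig j)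
    have hb : ∀ j, -z (a j) ≤ y := fun j => (neg_le_abs _).trans (hbig j)
    simp only [ha, hb, implies_true, and_true, Finset.sum_neg_distrib]
    rcases le_total 0 (∑ j, z (a j)) with h0 | h0
    · rw [abs_of_nonneg h0]
      split_ifs <;> linarith
    · rw [abs_of_nonpos h0]
      split_ifs <;> linarith

end ProductWeights

/-- Markov's inequality for a finitely supported weight, at exponent `p`. -/
lemma sum_mul_indicator_le {ι : Type*} [Fintype ι] {w z : ι → ℝ} (hw : ∀ a, 0 ≤ w a) {y p : ℝ}
    (hy : 0 < y) (hp : 0 ≤ p) :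
    ∑ a, w a * (if y < |z a| then (1 : ℝ) else 0) ≤ (∑ a, w a * |z a| ^ p) / y ^ p := by
  rw [Finset.sum_div]
  refine Finset.sum_le_sum fun a _ => ?_
  rw [mul_div_assoc]
  refine mul_le_mul_of_nonneg_left ?_ (hw a)
  split_ifs with h
  · rw [one_le_div (by positivity)]
    exact Real.rpow_le_rpow hy.le h.le hp
  · positivity

/-- Tail bound, averaged over `m` sample points, for the sum of `N` i.i.d. copies of a centred
variable bounded by `2`, in terms of averaged moments of order `lg (16 m)`. -/
lemma average_tail_le {ι : Type*} [Fintype ι] {m N : ℕ} (hm : 1 ≤ m) {w : ι → ℝ}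
    {z : Fin m → ι → ℝ} (hw : ∀ a, 0 ≤ w a) (hw1 : ∑ a, w a = 1)
    (hz : ∀ i, ∑ a, w a * z i a = 0) (hz2 : ∀ i a, |z i a| ≤ 2) {θ p : ℝ} (hθ : 1 / m ≤ θ)
    (hp : p = Real.logb 2 (16 * m)) (hN : 0 < N)
    (hN₁ : p * (256 * θ⁻¹ * ((1 / (m : ℝ)) * ∑ i, ∑ a, w a * |z i a| ^ p) ^ (1 / p)) ≤ N)
    (hN₂ : p * (128 * Real.exp 1 * θ⁻¹ ^ 2 *
      ((1 / (m : ℝ)) * ∑ i, (∑ a, w a * z i a ^ 2) ^ (p / 2)) ^ (2 / p)) ≤ N) :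
    (1 / (m : ℝ)) * ∑ i, ∑ hs : Fin N → ι, (∏ j, w (hs j)) *
        (if 49 * θ / 100 * N < |∑ j, z i (hs j)| then (1 : ℝ) else 0) ≤ 1 / (m : ℝ) ^ 2 := by
  have hmR : (1 : ℝ) ≤ m := by exact_mod_cast hm
  have hNR : (0 : ℝ) < N := by exact_mod_cast hN
  have hθ0 : 0 < θ := lt_of_lt_of_le (by positivity) hθ
  have h2p : (2 : ℝ) ^ p = 16 * m := by
    rw [hp]; exact Real.rpow_logb (by norm_num) (by norm_num) (by positivity)
  have hp0 : 0 < p := by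
    rw [hp]; exact Real.logb_pos (by norm_num) (by linarith)
  have hpm : p ≤ 32 * m := by
    have h1 : Real.log (16 * m) ≤ 16 * m := (Real.log_le_self (by positivity))
    rw [hp, Real.logb, div_le_iff₀ (Real.log_pos (by norm_num))]
    nlinarith [Real.log_two_gt_d9]
  set t := 49 * θ / 100 * N with ht
  set y := N * θ / (2 * p) with hy
  have hy0 : 0 < y := by positivity
  have ht0 : 0 < t := by positivity
  have hqt : p / 2 * y ≤ t := by
    have : p / 2 * y = N * θ / 4 := by rw [hy]; field_simp; ring
    rw [this, ht]
    nlinarith [mul_pos hNR hθ0]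
  have hs (i) : 0 ≤ ∑ a, w a * z i a ^ 2 :=
    Finset.sum_nonneg fun a _ => mul_nonneg (hw a) (sq_nonneg _)
  set c := Real.exp 1 * N / (t * y) with hc
  have hc0 : 0 < c := by positivity
  set U : Fin m → ℝ := fun i => ∑ a, w a * (if y < |z i a| then (1 : ℝ) else 0) with hU
  set A := (1 / (m : ℝ)) * ∑ i, (∑ a, w a * z i a ^ 2) ^ (p / 2) with hA
  have hA0 : 0 ≤ A := mul_nonneg (by positivity)
    (Finset.sum_nonneg fun i _ => Real.rpow_nonneg (hs i) _)
  set M := (1 / (m : ℝ)) * ∑ i, ∑ a, w a * |z i a| ^ p with hM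
  have hM0 : 0 ≤ M := mul_nonneg (by positivity) (Finset.sum_nonneg fun i _ =>
    Finset.sum_nonneg fun a _ => mul_nonneg (hw a) (Real.rpow_nonneg (abs_nonneg _) _))
  have hpoint (i) : ∑ hs : Fin N → ι, (∏ j, w (hs j)) *
        (if t < |∑ j, z i (hs j)| then (1 : ℝ) else 0) ≤
      N * U i + 2 * (c ^ (p / 2) * (∑ a, w a * z i a ^ 2) ^ (p / 2)) := by
    refine (fuk_nagaev hw hw1 (hz i) hy0 (half_pos hp0) hqt).trans_eq ?_
    rw [← Real.mul_rpow hc0.le (hs i), hc]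
    congr 3
    ring
  have hvar : c ^ (p / 2) * A ≤ 1 / (256 * (m : ℝ) ^ 2) := by
    have hAB : A = (A ^ (2 / p)) ^ (p / 2) := by
      rw [← Real.rpow_mul hA0, div_mul_div_cancel₀ hp0.ne', div_self two_ne_zero, Real.rpow_one]
    have hB0 : 0 ≤ A ^ (2 / p) := Real.rpow_nonneg hA0 _
    rw [hAB, ← Real.mul_rpow hc0.le hB0]
    set B := A ^ (2 / p)
    have hcB : c * B ≤ (2 ^ (-4 : ℝ) : ℝ) := by
      have e1 : c * B = 200 / (49 * 128) *
          (p * (128 * Real.exp 1 * θ⁻¹ ^ 2 * B) / N) := by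
        rw [hc, ht, hy]; field_simp; ring
      have e2 : p * (128 * Real.exp 1 * θ⁻¹ ^ 2 * B) / N ≤ 1 := (div_le_one hNR).mpr hN₂
      have e3 : (2 ^ (-4 : ℝ) : ℝ) = 1 / 16 := by
        rw [Real.rpow_neg (by norm_num)]; norm_num
      rw [e1, e3]
      linarith
    calc (c * B) ^ (p / 2) ≤ (2 ^ (-4 : ℝ) : ℝ) ^ (p / 2) :=
          Real.rpow_le_rpow (mul_nonneg hc0.le hB0) hcB (by positivity)
      _ = ((2 : ℝ) ^ p) ^ (-2 : ℝ) := by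
          rw [← Real.rpow_mul (by norm_num), ← Real.rpow_mul (by norm_num)]
          congr 1
          ring
      _ = 1 / (256 * (m : ℝ) ^ 2) := by
          rw [h2p, Real.rpow_neg (by positivity), Real.rpow_two, mul_pow, one_div]
          norm_num
  have hunion : N * ((1 / (m : ℝ)) * ∑ i, U i) ≤ 1 / (2 * (m : ℝ) ^ 2) := by
    rcases le_or_gt (128 * (m : ℝ) ^ 2) (N : ℝ) with hbig | hsmall
    · have hy2 : 2 ≤ y := by
        rw [hy, le_div_iff₀ (by positivity)]
        have h1 : 1 ≤ m * θ := by
          rwa [div_le_iff₀' (by positivity)] at hθ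
        have h2 : 128 * (m : ℝ) ≤ 128 * m ^ 2 * θ := by nlinarith
        nlinarith [mul_le_mul_of_nonneg_right hbig hθ0.le]
      have hU0 (i) : U i = 0 := by
        refine Finset.sum_eq_zero fun a _ => ?_
        rw [if_neg (not_lt.mpr ((hz2 i a).trans hy2)), mul_zero]
      simp only [hU0, Finset.sum_const_zero, mul_zero]
      positivity
    · have hUM : (1 / (m : ℝ)) * ∑ i, U i ≤ M / y ^ p := by
        rw [hM, mul_div_assoc, Finset.sum_div]
        exact mul_le_mul_of_nonneg_left
          (Finset.sum_le_sum fun i _ => sum_mul_indicator_le hw hy0 hp0.le) (by positivity)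
      have hMR : M = (M ^ (1 / p)) ^ p := by
        rw [← Real.rpow_mul hM0, one_div_mul_cancel hp0.ne', Real.rpow_one]
      have hR0 : 0 ≤ M ^ (1 / p) := Real.rpow_nonneg hM0 _
      rw [hMR, ← Real.div_rpow hR0 hy0.le] at hUM
      set R := M ^ (1 / p)
      have hUavg : 0 ≤ (1 / (m : ℝ)) * ∑ i, U i := by
        refine mul_nonneg (by positivity) (Finset.sum_nonneg fun i _ =>
          Finset.sum_nonneg fun a _ => mul_nonneg (hw a) ?_)
        split_ifs <;> norm_num
      have hRy : R / y ≤ (2 ^ (-7 : ℝ) : ℝ) := by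
        have e1 : R / y = 1 / 128 * (p * (256 * θ⁻¹ * R) / N) := by
          rw [hy]; field_simp; ring
        have e2 : p * (256 * θ⁻¹ * R) / N ≤ 1 := (div_le_one hNR).mpr hN₁
        have e3 : (2 ^ (-7 : ℝ) : ℝ) = 1 / 128 := by
          rw [Real.rpow_neg (by norm_num)]; norm_num
        rw [e1, e3]
        linarith
      have hpow : (R / y) ^ p ≤ 1 / (16 * (m : ℝ)) ^ 7 := by
        calc (R / y) ^ p ≤ (2 ^ (-7 : ℝ) : ℝ) ^ p :=
              Real.rpow_le_rpow (div_nonneg hR0 hy0.le) hRy hp0.le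
          _ = ((2 : ℝ) ^ p) ^ (-7 : ℝ) := by
              rw [← Real.rpow_mul (by norm_num), ← Real.rpow_mul (by norm_num), mul_comm]
          _ = 1 / (16 * (m : ℝ)) ^ 7 := by
              rw [h2p, Real.rpow_neg (by positivity), one_div]
              norm_cast
      calc N * ((1 / (m : ℝ)) * ∑ i, U i) ≤ 128 * (m : ℝ) ^ 2 * (1 / (16 * (m : ℝ)) ^ 7) := by
            exact mul_le_mul hsmall.le (hUM.trans hpow) hUavg (by positivity)
        _ = 128 * (m : ℝ) ^ 2 / (16 * (m : ℝ)) ^ 7 := by ring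
        _ ≤ 1 / (2 * (m : ℝ) ^ 2) := by
            rw [div_le_div_iff₀ (by positivity) (by positivity)]
            have : (m : ℝ) ^ 4 ≤ m ^ 7 := pow_le_pow_right₀ hmR (by norm_num)
            have h7 : 0 ≤ (m : ℝ) ^ 7 := by positivity
            ring_nf
            linarith
  calc _ ≤ (1 / (m : ℝ)) * ∑ i, (N * U i + 2 * (c ^ (p / 2) * (∑ a, w a * z i a ^ 2) ^ (p / 2))) :=
        mul_le_mul_of_nonneg_left (Finset.sum_le_sum fun i _ => hpoint i) (by positivity)
    _ = N * ((1 / (m : ℝ)) * ∑ i, U i) + 2 * (c ^ (p / 2) * A) := by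
        rw [Finset.sum_add_distrib, ← Finset.mul_sum, ← Finset.mul_sum, ← Finset.mul_sum, hA]
        ring
    _ ≤ 1 / (2 * (m : ℝ) ^ 2) + 2 * (1 / (256 * (m : ℝ) ^ 2)) := by gcongr
    _ = (65 / 128) * (1 / (m : ℝ) ^ 2) := by ring
    _ ≤ 1 / (m : ℝ) ^ 2 := by
        have : 0 < 1 / (m : ℝ) ^ 2 := by positivity
        linarith

/-- the randomized rounding `g = (1/N) ∑_j h_j`, `h_j ∼ Q(f)` i.i.d., is with
probability at least `1 - 1/m²` (jointly with a uniform sample point) within `49θ/100` of `f`. -/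
theorem rounding_close_whp :
    ∃ m₀ : ℕ, ∀ m : ℕ, m₀ ≤ m →
      ∀ (X : Type) (H : Finset (X → ℝ)), H.Nonempty →
        (∀ h ∈ H, ∀ x, -1 ≤ h x ∧ h x ≤ 1) →
        ∀ (α : (X → ℝ) → ℝ), (∀ h ∈ H, 0 ≤ α h) → (∑ h ∈ H, α h = 1) →
          ∀ (S : Fin m → X × ℝ) (θ : ℝ), 1 / m ≤ θ → θ ≤ 1 →
            ∀ N : ℕ,
              Real.logb 2 (16 * m) *
                max (max
                    (256 * θ⁻¹ *
                      ((1 / (m : ℝ)) * ∑ i : Fin m, ∑ h ∈ H,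
                          α h * |vote H α (S i).1 - h (S i).1| ^ Real.logb 2 (16 * m)) ^
                        (1 / Real.logb 2 (16 * m)))
                    (100 / θ))
                  (128 * Real.exp 1 * θ⁻¹ ^ 2 *
                    ((1 / (m : ℝ)) * ∑ i : Fin m,
                        (∑ h ∈ H, α h * (vote H α (S i).1 - h (S i).1) ^ 2) ^
                          (Real.logb 2 (16 * m) / 2)) ^
                      (2 / Real.logb 2 (16 * m))) ≤ (N : ℝ) →
              (1 / (m : ℝ)) * ∑ i : Fin m, ∑ hs : Fin N → {h // h ∈ H},
                  (∏ j, α ((hs j : X → ℝ))) *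
                    (if |vote H α (S i).1 - (∑ j, (hs j : X → ℝ) (S i).1) / N| > 49 * θ / 100
                      then (1 : ℝ) else 0) ≤
                1 / (m : ℝ) ^ 2 := by
  refine ⟨1, fun m hm X H _ hH α hα hα1 S θ hθ _ N hN => ?_⟩
  have hmR : (1 : ℝ) ≤ m := by exact_mod_cast hm
  have hθ0 : 0 < θ := lt_of_lt_of_le (by positivity) hθ
  have hlg : 0 < Real.logb 2 (16 * m) := Real.logb_pos (by norm_num) (by linarith)
  have hw1 : ∑ a : {h // h ∈ H}, α a = 1 := by rw [Finset.sum_coe_sort H α, hα1]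
  have hN0 : (0 : ℝ) < N := by
    refine lt_of_lt_of_le (mul_pos hlg ?_) hN
    exact lt_of_lt_of_le (by positivity) ((le_max_right _ _).trans (le_max_left _ _))
  have hvote (x : X) : vote H α x ∈ Set.Icc (-1 : ℝ) 1 := by
    constructor
    · calc (-1 : ℝ) = ∑ h ∈ H, α h * (-1) := by rw [← Finset.sum_mul, hα1, one_mul]
        _ ≤ vote H α x := Finset.sum_le_sum fun h hh =>
          mul_le_mul_of_nonneg_left (hH h hh x).1 (hα h hh)
    · calc vote H α x ≤ ∑ h ∈ H, α h * 1 := Finset.sum_le_sum fun h hh =>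
          mul_le_mul_of_nonneg_left (hH h hh x).2 (hα h hh)
        _ = 1 := by rw [← Finset.sum_mul, hα1, one_mul]
  have key := average_tail_le (N := N) hm (w := fun a : {h // h ∈ H} => α a)
    (z := fun i a => vote H α (S i).1 - (a : X → ℝ) (S i).1) (fun a => hα a a.2) hw1
    (fun i => by
      simp_rw [mul_sub]
      rw [Finset.sum_sub_distrib, ← Finset.sum_mul, hw1, one_mul,
        Finset.sum_coe_sort H (fun h => α h * h (S i).1), vote, sub_self])
    (fun i a => by
      have h1 := hvote (S i).1
      have h2 := hH a a.2 (S i).1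
      rw [abs_le]
      constructor <;> linarith [h1.1, h1.2])
    hθ rfl (by exact_mod_cast hN0)
    (by
      refine le_trans (mul_le_mul_of_nonneg_left ?_ hlg.le) hN
      refine le_trans (le_of_eq ?_) ((le_max_left _ _).trans (le_max_left _ _))
      congr 3
      exact Finset.sum_congr rfl fun i _ => Finset.sum_coe_sort H
        (fun h => α h * |vote H α (S i).1 - h (S i).1| ^ Real.logb 2 (16 * m)))
    (by
      refine le_trans (mul_le_mul_of_nonneg_left ?_ hlg.le) hN
      refine le_trans (le_of_eq ?_) (le_max_right _ _)
      congr 3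
      exact Finset.sum_congr rfl fun i _ => congrArg (· ^ _) (Finset.sum_coe_sort H
        (fun h => α h * (vote H α (S i).1 - h (S i).1) ^ 2)))
  refine le_trans (le_of_eq ?_) key
  congr 1
  refine Finset.sum_congr rfl fun i _ => Finset.sum_congr rfl fun hs _ => ?_
  congr 1
  refine if_congr ?_ rfl rfl
  have hsum : ∑ j, (vote H α (S i).1 - (hs j : X → ℝ) (S i).1) =
      (vote H α (S i).1 - (∑ j, (hs j : X → ℝ) (S i).1) / N) * N := by
    rw [Finset.sum_sub_distrib, sub_mul, div_mul_cancel₀ _ hN0.ne']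
    simp [mul_comm]
  rw [hsum, abs_mul, abs_of_pos hN0, mul_lt_mul_iff_left₀ hN0, gt_iff_lt]
end

section
/- For every constant α > 0 there exist constants C = C(α) > 0, β = β(α) > 0 and N₀ = N₀(α) ∈ ℕ such that the following holds. For every integer N ≥ N₀, every θ ∈ (1/N, 1/40), every integer m with (θ^{−2}·ln N)^{1+α} ≤ m ≤ 2^{N^β}, and every τ with (ln N · ln m)/(m·θ²) ≤ τ ≤ 1, there exist a set X, a finite set H of base learners h : X → {−1,1} with (1/C)·ln N ≤ ln|H| ≤ C·ln N, and a probability distribution D on X × {−1,1}, such that with probability at least 1/100 over an i.i.d. sample S ∼ D^m there exists a voting classifier f_S ∈ C(H) satisfying: (1) L_S^θ(f_S) ≤ τ; and (2) L_D(f_S) ≥ L_S^θ(f_S) + (1/C)·( (ln|H| · ln m)/(m·θ²) + sqrt( τ·ln(1/τ) · ln|H|/(m·θ²) ) ). -/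
open Finset

/-- Empirical margin loss `L_S^θ(f) = (1/m)|{i : y_i f(x_i) ≤ θ}|`. -/
noncomputable def empLoss {X : Type*} {m : ℕ} (S : Fin m → X × ℝ) (f : X → ℝ) (θ : ℝ) : ℝ :=
  (Nat.card {i : Fin m // (S i).2 * f (S i).1 ≤ θ} : ℝ) / m

/-- Probability of an event under a (discrete) distribution `D`. -/
noncomputable def pmfPr {α : Type*} (D : PMF α) (s : Set α) : ℝ :=
  (D.toOuterMeasure s).toReal

/-- Probability of an event for an i.i.d. sample `S ∼ D^m` of a discrete distribution `D`. -/
noncomputable def samplePr {α : Type*} (D : PMF α) (m : ℕ) (E : Set (Fin m → α)) : ℝ :=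
  (∑' S : Fin m → α, E.indicator (fun S => ∏ j, D (S j)) S).toReal

/-- A nontrivial real `±1`-valued additive character of a finite field of characteristic two. -/
structure IsSignChar {F : Type*} [Field F] [Fintype F] (ψ : F → ℝ) : Prop where
  sign : ∀ x, ψ x = 1 ∨ ψ x = -1
  map_add : ∀ x y, ψ (x + y) = ψ x * ψ y
  sum_mul : ∀ c, c ≠ 0 → ∑ a, ψ (a * c) = 0

theorem exists_isSignChar (F : Type*) [Field F] [Fintype F] [Algebra (ZMod 2) F] :
    ∃ ψ : F → ℝ, IsSignChar ψ := by
  classical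
  obtain ⟨φ, hφ⟩ : ∃ φ : Module.Dual (ZMod 2) F, φ 1 ≠ 0 := by
    by_contra! h
    exact one_ne_zero ((Module.forall_dual_apply_eq_zero_iff (ZMod 2) (1 : F)).1 h)
  have h01 : ∀ z : ZMod 2, z = 0 ∨ z = 1 := by decide
  have hadd : ∀ x y, (if φ (x + y) = 0 then (1 : ℝ) else -1)
      = (if φ x = 0 then (1 : ℝ) else -1) * (if φ y = 0 then (1 : ℝ) else -1) := by
    intro x y
    have h11 : (1 : ZMod 2) + 1 = 0 := by decide
    rcases h01 (φ x) with hx | hx <;> rcases h01 (φ y) with hy | hy <;>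
      simp [map_add, hx, hy, h11]
  refine ⟨fun x => if φ x = 0 then 1 else -1, ⟨fun x => ?_, hadd, fun c hc => ?_⟩⟩
  · by_cases h : φ x = 0 <;> simp [h]
  · set S : ℝ := ∑ a, if φ (a * c) = 0 then (1 : ℝ) else -1 with hS
    have h1 : S = -S := by
      calc S = ∑ a, if φ ((a + c⁻¹) * c) = 0 then (1 : ℝ) else -1 :=
            (Equiv.sum_comp (Equiv.addRight c⁻¹)
              (fun a => if φ (a * c) = 0 then (1 : ℝ) else -1)).symm
        _ = ∑ a, -(if φ (a * c) = 0 then (1 : ℝ) else -1) := by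
            refine Finset.sum_congr rfl fun a _ => ?_
            rw [add_mul, inv_mul_cancel₀ hc, hadd, if_neg hφ]; ring
        _ = -S := by rw [Finset.sum_neg_distrib]
    linarith

namespace IsSignChar

variable {F : Type*} [Field F] [Fintype F] {ψ : F → ℝ}

theorem map_zero (hψ : IsSignChar ψ) : ψ 0 = 1 := by
  have h := hψ.map_add 0 0
  rw [add_zero] at h
  rcases hψ.sign 0 with h1 | h1 <;> rw [h1] at h ⊢
  norm_num at h

theorem sum_mul_eq [DecidableEq F] (hψ : IsSignChar ψ) (c : F) :
    ∑ a, ψ (a * c) = if c = 0 then (Fintype.card F : ℝ) else 0 := by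
  split_ifs with h
  · simp [h, hψ.map_zero]
  · exact hψ.sum_mul c h

theorem sum_sum_eq [DecidableEq F] (hψ : IsSignChar ψ) (c c' : F) :
    ∑ p : F × F, ψ (p.1 * c + p.2 * c')
      = if c = 0 ∧ c' = 0 then (Fintype.card F : ℝ) ^ 2 else 0 := by
  rw [Fintype.sum_prod_type]
  simp_rw [hψ.map_add, ← Finset.mul_sum, ← Finset.sum_mul, hψ.sum_mul_eq]
  by_cases h : c = 0 <;> by_cases h' : c' = 0 <;> simp [h, h', sq]

end IsSignChar

/-- The weights of the columns `(x, x³)` of a double-error-correcting BCH code. -/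
def bchSum {F ι : Type*} [Field F] [Fintype ι] (ψ : F → ℝ) (e : ι → F) (y : ι → ℝ)
    (p : F × F) : ℝ :=
  ∑ i, y i * ψ (p.1 * e i + p.2 * e i ^ 3)

theorem char_two_pairing {F : Type*} [Field F] [CharP F 2] {a b c d : F}
    (h1 : a + b + c + d = 0) (h3 : a ^ 3 + b ^ 3 + c ^ 3 + d ^ 3 = 0) :
    (a = b ∧ c = d) ∨ (a = c ∧ b = d) ∨ (a = d ∧ b = c) := by
  have h2 : (2 : F) = 0 := CharTwo.two_eq_zero
  have hd : d = a + b + c := by linear_combination h1 - (a + b + c) * h2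
  have h : (a + b) * (a + c) * (b + c) = 0 := by
    subst hd
    linear_combination h3 - (a ^ 3 + b ^ 3 + c ^ 3 + a ^ 2 * b + a ^ 2 * c + a * b ^ 2 + a * c ^ 2
      + b ^ 2 * c + b * c ^ 2 + 2 * a * b * c) * h2
  have key : ∀ x y : F, x + y = 0 → x = y := fun x y hxy => by
    linear_combination hxy - y * h2
  rcases mul_eq_zero.1 h with h | h
  · rcases mul_eq_zero.1 h with h | h
    · have := key _ _ h
      subst this; left; refine ⟨rfl, ?_⟩; rw [hd]; linear_combination -a * h2
    · have := key _ _ h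
      subst this; right; left; refine ⟨rfl, ?_⟩; rw [hd]; linear_combination -a * h2
  · have := key _ _ h
    subst this; right; right; refine ⟨?_, rfl⟩; rw [hd]; linear_combination -b * h2

section Moments

variable {F ι : Type*} [Field F] [Fintype F] [CharP F 2] [Fintype ι] {ψ : F → ℝ} {e : ι → F}

theorem sum_bchSum_sq (hψ : IsSignChar ψ) (he : Function.Injective e) (y : ι → ℝ) :
    ∑ p, bchSum ψ e y p ^ 2 = (Fintype.card F : ℝ) ^ 2 * ∑ i, y i ^ 2 := by
  classical
  have h1 : ∀ p, bchSum ψ e y p ^ 2 = ∑ i, ∑ j, y i * y j *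
      ψ (p.1 * (e i + e j) + p.2 * (e i ^ 3 + e j ^ 3)) := by
    intro p
    rw [sq, bchSum, Finset.sum_mul_sum]
    refine Finset.sum_congr rfl fun i _ => Finset.sum_congr rfl fun j _ => ?_
    rw [show p.1 * (e i + e j) + p.2 * (e i ^ 3 + e j ^ 3)
      = (p.1 * e i + p.2 * e i ^ 3) + (p.1 * e j + p.2 * e j ^ 3) by ring,
      hψ.map_add (p.1 * e i + p.2 * e i ^ 3)]
    ring
  simp_rw [h1]
  rw [Finset.sum_comm]
  simp_rw [Finset.sum_comm (s := (univ : Finset (F × F))), ← Finset.mul_sum, hψ.sum_sum_eq]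
  rw [Finset.mul_sum]
  refine Finset.sum_congr rfl fun i _ => ?_
  rw [Finset.sum_eq_single i]
  · rw [if_pos ⟨CharTwo.add_self_eq_zero _, CharTwo.add_self_eq_zero _⟩]; ring
  · intro j _ hj
    rw [if_neg, mul_zero]
    rintro ⟨h, -⟩
    exact hj (he (CharTwo.add_eq_zero.1 h)).symm
  · simp

theorem sum_bchSum_pow_four_le (hψ : IsSignChar ψ) (he : Function.Injective e)
    (y : ι → ℝ) :
    ∑ p, bchSum ψ e y p ^ 4 ≤ 3 * (Fintype.card F : ℝ) ^ 2 * (∑ i, y i ^ 2) ^ 2 := by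
  classical
  have h1 : ∀ p, bchSum ψ e y p ^ 4 = ∑ i, ∑ j, ∑ k, ∑ l, y i * y j * y k * y l *
      ψ (p.1 * (e i + e j + e k + e l) + p.2 * (e i ^ 3 + e j ^ 3 + e k ^ 3 + e l ^ 3)) := by
    intro p
    rw [show bchSum ψ e y p ^ 4 = bchSum ψ e y p * (bchSum ψ e y p *
      (bchSum ψ e y p * bchSum ψ e y p)) by ring]
    simp only [bchSum]
    rw [Finset.sum_mul_sum, Finset.sum_mul_sum, Finset.sum_mul_sum]
    refine Finset.sum_congr rfl fun i _ => Finset.sum_congr rfl fun j _ => ?_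
    rw [Finset.mul_sum]
    refine Finset.sum_congr rfl fun k _ => ?_
    rw [Finset.mul_sum, Finset.mul_sum]
    refine Finset.sum_congr rfl fun l _ => ?_
    rw [show p.1 * (e i + e j + e k + e l) + p.2 * (e i ^ 3 + e j ^ 3 + e k ^ 3 + e l ^ 3)
      = (p.1 * e i + p.2 * e i ^ 3) + ((p.1 * e j + p.2 * e j ^ 3) +
        ((p.1 * e k + p.2 * e k ^ 3) + (p.1 * e l + p.2 * e l ^ 3))) by ring,
      hψ.map_add (p.1 * e i + p.2 * e i ^ 3), hψ.map_add (p.1 * e j + p.2 * e j ^ 3),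
      hψ.map_add (p.1 * e k + p.2 * e k ^ 3)]
    ring
  simp_rw [h1]
  simp_rw [Finset.sum_comm (s := (univ : Finset (F × F))), ← Finset.mul_sum, hψ.sum_sum_eq]
  set Q : ℝ := (Fintype.card F : ℝ) ^ 2
  have hQ : 0 ≤ Q := by positivity
  have h2 : ∀ i j k l, y i * y j * y k * y l *
      (if e i + e j + e k + e l = 0 ∧ e i ^ 3 + e j ^ 3 + e k ^ 3 + e l ^ 3 = 0 then Q else 0)
      ≤ Q * ((if i = j ∧ k = l then y i ^ 2 * y k ^ 2 else 0) +
        (if i = k ∧ j = l then y i ^ 2 * y j ^ 2 else 0) +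
        (if i = l ∧ j = k then y i ^ 2 * y j ^ 2 else 0)) := by
    intro i j k l
    have n1 : 0 ≤ (if i = j ∧ k = l then y i ^ 2 * y k ^ 2 else 0) := by positivity
    have n2 : 0 ≤ (if i = k ∧ j = l then y i ^ 2 * y j ^ 2 else 0) := by positivity
    have n3 : 0 ≤ (if i = l ∧ j = k then y i ^ 2 * y j ^ 2 else 0) := by positivity
    by_cases h : e i + e j + e k + e l = 0 ∧ e i ^ 3 + e j ^ 3 + e k ^ 3 + e l ^ 3 = 0
    · rw [if_pos h]
      rcases char_two_pairing h.1 h.2 with ⟨h, h'⟩ | ⟨h, h'⟩ | ⟨h, h'⟩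
      · have h3 : i = j ∧ k = l := ⟨he h, he h'⟩
        rw [if_pos h3]
        rw [h3.1, h3.2] at n2 n3 ⊢
        nlinarith [mul_nonneg hQ n2, mul_nonneg hQ n3]
      · have h3 : i = k ∧ j = l := ⟨he h, he h'⟩
        rw [if_pos h3]
        rw [h3.1, h3.2] at n1 n3 ⊢
        nlinarith [mul_nonneg hQ n1, mul_nonneg hQ n3]
      · have h3 : i = l ∧ j = k := ⟨he h, he h'⟩
        rw [if_pos h3]
        rw [h3.1, h3.2] at n1 n2 ⊢
        nlinarith [mul_nonneg hQ n1, mul_nonneg hQ n2]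
    · rw [if_neg h, mul_zero]; positivity
  refine (Finset.sum_le_sum fun i _ => Finset.sum_le_sum fun j _ => Finset.sum_le_sum fun k _ =>
    Finset.sum_le_sum fun l _ => h2 i j k l).trans (le_of_eq ?_)
  simp_rw [← Finset.mul_sum, Finset.sum_add_distrib, ite_and]
  simp only [Finset.sum_ite_eq, Finset.mem_univ, if_true, Finset.sum_ite_irrel,
    Finset.sum_const_zero]
  simp_rw [← Finset.mul_sum, ← Finset.sum_mul]
  ring

/-- A Khintchine-type inequality: the fourth moment bound forces a large first moment. -/
theorem le_sum_abs_bchSum (hψ : IsSignChar ψ) (he : Function.Injective e)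
    {G : ℝ} (hG : 4 * G ^ 2 * Fintype.card ι ≤ 1) (y : ι → ℝ) :
    (Fintype.card F : ℝ) ^ 2 * (G * ∑ i, |y i|) ≤ ∑ p, |bchSum ψ e y p| := by
  set V := ∑ i, y i ^ 2 with hV
  have hV0 : 0 ≤ V := Finset.sum_nonneg fun i _ => sq_nonneg _
  set Q : ℝ := (Fintype.card F : ℝ) ^ 2 with hQ
  have hQ0 : 0 ≤ Q := by positivity
  set σ := Real.sqrt V with hσ
  have hσV : σ ^ 2 = V := Real.sq_sqrt hV0
  have h1 : G * ∑ i, |y i| ≤ σ / 2 := by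
    have hcs : (∑ i, |y i|) ^ 2 ≤ Fintype.card ι * V := by
      have := sq_sum_le_card_mul_sum_sq (s := (univ : Finset ι)) (f := fun i => |y i|)
      simpa [sq_abs] using this
    refine abs_le_of_sq_le_sq' ?_ (by positivity) |>.2
    have : (G * ∑ i, |y i|) ^ 2 ≤ G ^ 2 * (Fintype.card ι * V) := by
      rw [mul_pow]; gcongr
    nlinarith
  refine (mul_le_mul_of_nonneg_left h1 hQ0).trans ?_
  rcases (Real.sqrt_nonneg V).eq_or_lt with h0 | h0
  · rw [hσ, ← h0]; simp; exact Finset.sum_nonneg fun _ _ => abs_nonneg _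
  · have hpt : ∀ p, 12 * σ ^ 2 * bchSum ψ e y p ^ 2 - bchSum ψ e y p ^ 4
        ≤ 16 * σ ^ 3 * |bchSum ψ e y p| := by
      intro p
      rw [← sq_abs (bchSum ψ e y p), show bchSum ψ e y p ^ 4 = |bchSum ψ e y p| ^ 4 by
        rw [Even.pow_abs (by decide)]]
      set t := |bchSum ψ e y p|
      have ht : 0 ≤ t := abs_nonneg _
      have : 0 ≤ t * ((t - 2 * σ) ^ 2 * (t + 4 * σ)) := by positivity
      nlinarith
    have hsum := Finset.sum_le_sum fun p (_ : p ∈ (univ : Finset (F × F))) => hpt p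
    rw [Finset.sum_sub_distrib, ← Finset.mul_sum, ← Finset.mul_sum, sum_bchSum_sq hψ he,
      ← hV, ← hQ, ← hσV] at hsum
    have h4 := sum_bchSum_pow_four_le hψ he y
    rw [← hV, ← hQ, ← hσV] at h4
    have h5 : 16 * σ ^ 3 * (Q * (σ / 2)) ≤ 16 * σ ^ 3 * ∑ p, |bchSum ψ e y p| := by
      have : 0 ≤ Q * σ ^ 4 := by positivity
      nlinarith
    exact le_of_mul_le_mul_left h5 (by positivity)

end Moments

theorem exists_weights_of_support {I J : Type*} [Fintype I] [Fintype J] (z : I → J → ℝ) {G : ℝ}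
    (h : ∀ y : J → ℝ, ∃ i, G * ∑ j, |y j| ≤ ∑ j, y j * z i j) (v : J → ℝ)
    (hv : ∀ j, |v j| ≤ G) :
    ∃ w : I → ℝ, (∀ i, 0 ≤ w i) ∧ ∑ i, w i = 1 ∧ ∀ j, ∑ i, w i * z i j = v j := by
  classical
  set L : (I → ℝ) →ₗ[ℝ] (J → ℝ) :=
    { toFun := fun w j => ∑ i, w i * z i j
      map_add' := fun a b => by ext j; simp [add_mul, Finset.sum_add_distrib]
      map_smul' := fun a b => by ext j; simp [Finset.mul_sum, mul_assoc] } with hL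
  have hcont : Continuous L := L.continuous_of_finiteDimensional
  by_contra hne
  have hv' : v ∉ L '' stdSimplex ℝ I := by
    rintro ⟨w, hw, rfl⟩
    exact hne ⟨w, hw.1, hw.2, fun j => rfl⟩
  obtain ⟨f, u, hf1, hf2⟩ := geometric_hahn_banach_closed_point
    ((convex_stdSimplex ℝ I).linear_image L)
    ((isCompact_stdSimplex ℝ I).image hcont).isClosed hv'
  have hfs : ∀ x : J → ℝ, f x = ∑ j, f (Pi.single j 1) * x j := by
    intro x
    have := LinearMap.pi_apply_eq_sum_univ f.toLinearMap x
    simp only [ContinuousLinearMap.coe_coe, smul_eq_mul] at this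
    rw [this]
    refine Finset.sum_congr rfl fun j _ => ?_
    rw [mul_comm]; congr 2; ext k; simp [Pi.single_apply, eq_comm]
  obtain ⟨i, hi⟩ := h fun j => f (Pi.single j 1)
  have h1 := hf1 _ ⟨Pi.single i 1, single_mem_stdSimplex ℝ i, rfl⟩
  have h2 : L (Pi.single i 1) = z i := by
    ext j; simp [hL, Pi.single_apply]
  rw [h2, hfs] at h1
  have h3 : f v ≤ G * ∑ j, |f (Pi.single j 1)| := by
    rw [hfs, Finset.mul_sum]
    refine Finset.sum_le_sum fun j _ => (le_abs_self _).trans ?_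
    rw [abs_mul, mul_comm]
    exact mul_le_mul_of_nonneg_right (hv j) (abs_nonneg _)
  linarith

section SignSystem

variable {F : Type*} [Field F] [Fintype F] [CharP F 2] {ψ : F → ℝ}

/-- The sign of a Boolean. -/
def boolSign (b : Bool) : ℝ := if b then 1 else -1

theorem exists_boolSign_mul_eq_abs (x : ℝ) : ∃ b, boolSign b * x = |x| := by
  rcases abs_choice x with h | h
  · exact ⟨true, by simp [boolSign, h]⟩
  · exact ⟨false, by simp [boolSign, h]⟩

theorem boolSign_eq (b : Bool) : boolSign b = 1 ∨ boolSign b = -1 := by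
  cases b <;> simp [boolSign]

theorem exists_index_bchSum {κ ι : Type*} [Fintype κ] [Fintype ι] {e : ι → F}
    (hψ : IsSignChar ψ) (he : Function.Injective e)
    {G : ℝ} (hG : 4 * G ^ 2 * Fintype.card ι ≤ 1) (y : κ × ι → ℝ) :
    ∃ i : (κ → Bool) × F × F, G * ∑ j, |y j| ≤ ∑ j, y j *
      (boolSign (i.1 j.1) * ψ (i.2.1 * e j.2 + i.2.2 * e j.2 ^ 3)) := by
  have h1 : ∑ _p : F × F, G * ∑ j, |y j|
      ≤ ∑ p, ∑ k, |bchSum ψ e (fun i => y (k, i)) p| := by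
    rw [Finset.sum_comm, Finset.sum_const, Finset.card_univ, Fintype.card_prod, nsmul_eq_mul,
      Fintype.sum_prod_type, Finset.mul_sum, Finset.mul_sum]
    refine Finset.sum_le_sum fun k _ => ?_
    have := le_sum_abs_bchSum hψ he hG fun i => y (k, i)
    rwa [sq, ← Nat.cast_mul] at this
  obtain ⟨p, -, hp⟩ := Finset.exists_le_of_sum_le Finset.univ_nonempty h1
  choose ε hε using fun k => exists_boolSign_mul_eq_abs (bchSum ψ e (fun i => y (k, i)) p)
  refine ⟨(ε, p), hp.trans (le_of_eq ?_)⟩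
  rw [Fintype.sum_prod_type]
  refine Finset.sum_congr rfl fun k _ => ?_
  rw [← hε, bchSum, Finset.mul_sum]
  exact Finset.sum_congr rfl fun i _ => by ring

theorem exists_sign_code (hψ : IsSignChar ψ) {r K : ℕ} (hr : r ≤ Fintype.card F ^ K)
    (hK : 2 * K ≤ Fintype.card F) :
    ∃ c : Fin r → F × F → ℝ, (∀ s l, c s l = 1 ∨ c s l = -1) ∧
      ∀ s s', s ≠ s' → ∑ l, c s l * c s' l ≤ (Fintype.card F : ℝ) ^ 2 / 2 := by
  classical
  obtain ⟨g⟩ : Nonempty (Fin r ↪ (Fin K → F)) :=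
    Function.Embedding.nonempty_of_card_le (by simpa using hr)
  let P : Fin r → Polynomial F := fun s => ((Polynomial.degreeLTEquiv F K).symm (g s) :)
  have hPinj : Function.Injective P := fun s s' h =>
    g.injective ((Polynomial.degreeLTEquiv F K).symm.injective (Subtype.ext h))
  have hdeg : ∀ s, (P s).degree < K := fun s =>
    Polynomial.mem_degreeLT.1 ((Polynomial.degreeLTEquiv F K).symm (g s)).2
  refine ⟨fun s l => ψ (l.2 * (P s).eval l.1), fun s l => hψ.sign _, fun s s' hs => ?_⟩
  have hne : P s - P s' ≠ 0 := sub_ne_zero.2 fun h => hs (hPinj h)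
  have hcard : ((univ.filter fun x => (P s - P s').eval x = 0).card : ℝ) ≤ K := by
    have h1 : (univ.filter fun x => (P s - P s').eval x = 0).card ≤ (P s - P s').natDegree := by
      refine Polynomial.card_le_degree_of_subset_roots fun x hx => ?_
      rw [Polynomial.mem_roots hne]
      simpa using hx
    have h2 : (P s - P s').natDegree < K := by
      rw [Polynomial.natDegree_lt_iff_degree_lt hne]
      exact (Polynomial.degree_sub_le _ _).trans_lt (max_lt (hdeg s) (hdeg s'))
    exact_mod_cast (h1.trans h2.le)
  have h1 : ∀ x a : F, ψ (a * (P s).eval x) * ψ (a * (P s').eval x)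
      = ψ (a * (P s - P s').eval x) := by
    intro x a
    rw [← hψ.map_add, ← mul_add, Polynomial.eval_sub, CharTwo.sub_eq_add]
  rw [Fintype.sum_prod_type]
  simp_rw [h1, hψ.sum_mul_eq]
  rw [← Finset.sum_filter, Finset.sum_const, nsmul_eq_mul]
  have hK' : (2 : ℝ) * K ≤ Fintype.card F := by exact_mod_cast hK
  nlinarith [(Nat.cast_nonneg (Fintype.card F) : (0 : ℝ) ≤ _)]

theorem exists_transversal_system {κ ι : Type*} [Fintype κ] [DecidableEq κ] [Fintype ι] {e : ι → F}
    (hψ : IsSignChar ψ) (he : Function.Injective e) {G : ℝ} (hG0 : 0 ≤ G)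
    (hG : 4 * G ^ 2 * Fintype.card ι ≤ 1) {r K : ℕ} (hr : r ≤ Fintype.card F ^ K)
    (hK : 2 * K ≤ Fintype.card F) :
    ∃ hyp : (F × F) × ((κ → Bool) × F × F) → (κ × ι) × Fin r → ℝ,
      (∀ i x, hyp i x = 1 ∨ hyp i x = -1) ∧
      ∀ t : κ × ι → Option (Fin r), ∃ w : (F × F) × ((κ → Bool) × F × F) → ℝ,
        (∀ i, 0 ≤ w i) ∧ ∑ i, w i = 1 ∧
        ∀ x, (t x.1 = some x.2 → ∑ i, w i * hyp i x = -G) ∧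
          (t x.1 ≠ some x.2 → -(G / 2) ≤ ∑ i, w i * hyp i x) := by
  classical
  obtain ⟨c, hc1, hc2⟩ := exists_sign_code hψ hr hK
  have hcabs : ∀ s l, |c s l| = 1 := fun s l => by rcases hc1 s l with h | h <;> simp [h]
  have hcsq : ∀ s l, c s l * c s l = 1 := fun s l => by rcases hc1 s l with h | h <;> simp [h]
  set z : (κ → Bool) × F × F → κ × ι → ℝ := fun i j =>
    boolSign (i.1 j.1) * ψ (i.2.1 * e j.2 + i.2.2 * e j.2 ^ 3) with hz
  have hQ : (0 : ℝ) < (Fintype.card F : ℝ) ^ 2 := by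
    have : 0 < Fintype.card F := Fintype.card_pos
    positivity
  refine ⟨fun i x => z i.2 x.1 * c x.2 i.1, fun i x => ?_, fun t => ?_⟩
  · rcases boolSign_eq (i.2.1 x.1.1) with h1 | h1 <;>
    rcases hψ.sign (i.2.2.1 * e x.1.2 + i.2.2.2 * e x.1.2 ^ 3) with h2 | h2 <;>
    rcases hc1 x.2 i.1 with h3 | h3 <;> simp [hz, h1, h2, h3]
  · set v : F × F → κ × ι → ℝ := fun l j => (t j).elim 0 fun s => -(G * c s l) with hv
    have hvG : ∀ l j, |v l j| ≤ G := by
      intro l j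
      rcases h : t j with _ | s
      · simpa [hv, h] using hG0
      · simp [hv, h, abs_mul, hcabs, abs_of_nonneg hG0]
    choose w hw0 hw1 hwv using fun l =>
      exists_weights_of_support z (exists_index_bchSum hψ he hG) (v l) (hvG l)
    refine ⟨fun i => w i.1 i.2 / (Fintype.card F : ℝ) ^ 2, fun i => div_nonneg (hw0 _ _) hQ.le,
      ?_, fun x => ?_⟩
    · rw [Fintype.sum_prod_type]
      simp_rw [← Finset.sum_div, hw1]
      simp [Fintype.card_prod, sq]
    · have hsum : ∑ i : (F × F) × ((κ → Bool) × F × F),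
          w i.1 i.2 / (Fintype.card F : ℝ) ^ 2 * (z i.2 x.1 * c x.2 i.1)
          = (∑ l, v l x.1 * c x.2 l) / (Fintype.card F : ℝ) ^ 2 := by
        rw [Fintype.sum_prod_type, Finset.sum_div]
        refine Finset.sum_congr rfl fun l _ => ?_
        rw [← hwv, Finset.sum_mul, Finset.sum_div]
        exact Finset.sum_congr rfl fun i _ => by ring
      rw [hsum]
      have hsome : ∀ s, t x.1 = some s →
          ∑ l, v l x.1 * c x.2 l = -G * ∑ l, c s l * c x.2 l := by
        intro s hs
        rw [Finset.mul_sum]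
        exact Finset.sum_congr rfl fun l _ => by simp [hv, hs]; ring
      constructor
      · intro h
        rw [hsome _ h]
        simp_rw [hcsq]
        simp [Fintype.card_prod]
        field_simp
      · intro h
        rw [le_div_iff₀ hQ]
        rcases hs : t x.1 with _ | s
        · simp [hv, hs]; positivity
        · rw [hsome s hs]
          have := hc2 s x.2 (by rintro rfl; exact h hs)
          nlinarith [mul_le_mul_of_nonneg_left this hG0]

end SignSystem

theorem card_div_eight_le_of_second_moment {Ω : Type*} [Fintype Ω] (V : Ω → ℝ)
    (hpos : 0 < ∑ ω, V ω)
    (h2 : Fintype.card Ω * ∑ ω, V ω ^ 2 ≤ 2 * (∑ ω, V ω) ^ 2) :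
    (Fintype.card Ω : ℝ) / 8
      ≤ (univ.filter fun ω => ∑ ω, V ω ≤ 2 * Fintype.card Ω * V ω).card := by
  classical
  set A := ∑ ω, V ω with hA
  set M : ℝ := (Fintype.card Ω : ℝ) with hM
  set T := univ.filter fun ω => A ≤ 2 * M * V ω with hT
  have hM0 : 0 < M := by
    have : Nonempty Ω := by
      by_contra h
      rw [not_nonempty_iff] at h
      simp [hA] at hpos
    rw [hM]; exact_mod_cast Fintype.card_pos (α := Ω)
  have h1 : A ≤ A / 2 + ∑ ω ∈ T, V ω := by
    have hsplit : A = ∑ ω ∈ T, V ω + ∑ ω ∈ univ.filter (fun ω => ¬ A ≤ 2 * M * V ω), V ω :=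
      (Finset.sum_filter_add_sum_filter_not _ _ _).symm
    have hle : ∑ ω ∈ univ.filter (fun ω => ¬ A ≤ 2 * M * V ω), V ω ≤ A / 2 := by
      calc ∑ ω ∈ univ.filter (fun ω => ¬ A ≤ 2 * M * V ω), V ω
          ≤ ∑ ω ∈ univ.filter (fun ω => ¬ A ≤ 2 * M * V ω), A / (2 * M) := by
            refine Finset.sum_le_sum fun ω hω => ?_
            rw [le_div_iff₀ (by positivity)]
            have := (Finset.mem_filter.1 hω).2
            linarith
        _ ≤ ∑ _ω : Ω, A / (2 * M) :=
            Finset.sum_le_sum_of_subset_of_nonneg (Finset.filter_subset _ _)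
              fun _ _ _ => by positivity
        _ = A / 2 := by
            rw [Finset.sum_const, Finset.card_univ, nsmul_eq_mul, ← hM]; field_simp
    linarith
  have h3 : (∑ ω ∈ T, V ω) ^ 2 ≤ T.card * ∑ ω, V ω ^ 2 :=
    sq_sum_le_card_mul_sum_sq.trans (mul_le_mul_of_nonneg_left
      (Finset.sum_le_sum_of_subset_of_nonneg (Finset.subset_univ _)
        fun _ _ _ => sq_nonneg _) (Nat.cast_nonneg _))
  have h4 : (A / 2) ^ 2 ≤ (∑ ω ∈ T, V ω) ^ 2 := by
    apply pow_le_pow_left₀ (by positivity); linarith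
  have h5 : M * (A / 2) ^ 2 ≤ T.card * (2 * A ^ 2) := by
    calc M * (A / 2) ^ 2 ≤ M * (T.card * ∑ ω, V ω ^ 2) :=
          mul_le_mul_of_nonneg_left (h4.trans h3) hM0.le
      _ = T.card * (M * ∑ ω, V ω ^ 2) := by ring
      _ ≤ _ := mul_le_mul_of_nonneg_left h2 (Nat.cast_nonneg _)
  have hA2 : 0 < A ^ 2 := by positivity
  refine le_of_mul_le_mul_right ?_ hA2
  linarith

/-- The number of occurrences of `y` in the sample `S`. -/
def occ {Y : Type*} [DecidableEq Y] {m : ℕ} (S : Fin m → Y) (y : Y) : ℕ :=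
  (univ.filter fun i => S i = y).card

section Occ

variable {Y : Type*} [DecidableEq Y] {m : ℕ}

theorem pow_occ_eq_prod (ρ : ℝ) (S : Fin m → Y) (y : Y) :
    ρ ^ occ S y = ∏ i, if S i = y then ρ else 1 := by
  rw [Finset.prod_ite]; simp [occ]

variable [Fintype Y]

theorem sum_ite_eq_one (ρ : ℝ) (y : Y) :
    ∑ z, (if z = y then ρ else 1) = Fintype.card Y - (1 - ρ) := by
  have : ∀ z, (if z = y then ρ else 1) = 1 - (if z = y then 1 - ρ else 0) := fun z => by
    split_ifs <;> ring
  simp_rw [this]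
  simp

theorem sum_pow_occ (ρ : ℝ) (y : Y) :
    ∑ S : Fin m → Y, ρ ^ occ S y = (Fintype.card Y - (1 - ρ)) ^ m := by
  simp_rw [pow_occ_eq_prod]
  rw [← Fintype.sum_pow fun z => if z = y then ρ else 1, sum_ite_eq_one]

theorem sum_pow_occ_mul_pow_occ (ρ : ℝ) {y y' : Y} (h : y ≠ y') :
    ∑ S : Fin m → Y, ρ ^ occ S y * ρ ^ occ S y' = (Fintype.card Y - 2 * (1 - ρ)) ^ m := by
  simp_rw [pow_occ_eq_prod, ← Finset.prod_mul_distrib]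
  rw [← Fintype.sum_pow fun z => (if z = y then ρ else 1) * (if z = y' then ρ else 1)]
  congr 1
  have : ∀ z, (if z = y then ρ else 1) * (if z = y' then ρ else 1)
      = (if z = y then ρ else 1) + (if z = y' then ρ else 1) - 1 := fun z => by
    by_cases h1 : z = y
    · subst h1; simp [h]
    · simp [h1]
  simp_rw [this]
  rw [Finset.sum_sub_distrib, Finset.sum_add_distrib, sum_ite_eq_one, sum_ite_eq_one]
  simp
  ring

theorem card_div_eight_le_exists_occ (B : Finset Y) {x : ℝ} (hx0 : 0 < x) (hx1 : x < 1)
    (hB : 0 < B.card) (hY : 2 ≤ Fintype.card Y)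
    (hm : m * x ^ 2 / (Fintype.card Y - 1) ≤ Real.log B.card) :
    ((Fintype.card Y : ℝ) ^ m) / 8 ≤ (univ.filter fun S : Fin m → Y =>
      ∃ y ∈ B, (1 - x / Fintype.card Y) ^ m ≤ 2 * (1 - x) ^ occ S y).card := by
  classical
  set u : ℝ := (Fintype.card Y : ℝ) with hu
  set r : ℝ := (B.card : ℝ) with hr
  have hu2 : 2 ≤ u := by rw [hu]; exact_mod_cast hY
  have hr0 : 0 < r := by rw [hr]; exact_mod_cast hB
  set V : (Fin m → Y) → ℝ := fun S => ∑ y ∈ B, (1 - x) ^ occ S y with hV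
  have hsum : ∑ S, V S = r * (u - x) ^ m := by
    rw [Finset.sum_comm]
    simp_rw [sum_pow_occ]
    rw [Finset.sum_const, nsmul_eq_mul, sub_sub_cancel]
  have hux : 0 < u - x := by linarith
  have hsum2 : ∑ S, V S ^ 2 ≤ r * (u - 2 * x + x ^ 2) ^ m + r * (r * (u - 2 * x) ^ m) := by
    have h1 : ∑ S, V S ^ 2
        = ∑ y ∈ B, ∑ y' ∈ B, ∑ S : Fin m → Y, (1 - x) ^ occ S y * (1 - x) ^ occ S y' := by
      simp_rw [hV, sq, Finset.sum_mul_sum]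
      rw [Finset.sum_comm]
      exact Finset.sum_congr rfl fun y _ => Finset.sum_comm
    have hnn : 0 ≤ (u - 2 * x) ^ m := pow_nonneg (by linarith) _
    have h2 : ∀ y y' : Y, ∑ S : Fin m → Y, (1 - x) ^ occ S y * (1 - x) ^ occ S y'
        ≤ (if y' = y then (u - 2 * x + x ^ 2) ^ m else 0) + (u - 2 * x) ^ m := by
      intro y y'
      split_ifs with h
      · subst h
        simp_rw [← mul_pow]
        rw [sum_pow_occ]
        have : u - (1 - (1 - x) * (1 - x)) = u - 2 * x + x ^ 2 := by ring
        rw [← hu, this]; linarith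
      · rw [sum_pow_occ_mul_pow_occ _ (Ne.symm h), ← hu, sub_sub_cancel]; simp
    rw [h1]
    refine (Finset.sum_le_sum fun y _ => Finset.sum_le_sum fun y' _ => h2 y y').trans
      (le_of_eq ?_)
    simp_rw [Finset.sum_add_distrib]
    rw [Finset.sum_congr rfl fun y hy => by rw [Finset.sum_ite_eq' B y, if_pos hy]]
    simp [hr]
  have hcard : (Fintype.card (Fin m → Y) : ℝ) = u ^ m := by simp [hu]
  have hpos : 0 < ∑ S, V S := by rw [hsum]; positivity
  have hkey : u ^ m * (u - 2 * x + x ^ 2) ^ m ≤ r * ((u - x) ^ m) ^ 2 := by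
    have h1 : u * (u - 2 * x + x ^ 2) ≤ (u - x) ^ 2 * Real.exp (x ^ 2 / (u - 1)) := by
      have h2 : x ^ 2 / (u - 1) + 1 ≤ Real.exp (x ^ 2 / (u - 1)) := Real.add_one_le_exp _
      have h3 : u * (u - 2 * x + x ^ 2) ≤ (u - x) ^ 2 * (x ^ 2 / (u - 1) + 1) := by
        have h4 : (u - 1) ^ 2 * (x ^ 2 / (u - 1)) = (u - 1) * x ^ 2 := by
          have : u - 1 ≠ 0 := by linarith
          field_simp
        have h5 : (u - 1) ^ 2 * (x ^ 2 / (u - 1)) ≤ (u - x) ^ 2 * (x ^ 2 / (u - 1)) := by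
          have : 0 ≤ x ^ 2 / (u - 1) := div_nonneg (sq_nonneg _) (by linarith)
          gcongr; linarith
        nlinarith
      exact h3.trans (mul_le_mul_of_nonneg_left h2 (sq_nonneg _))
    calc u ^ m * (u - 2 * x + x ^ 2) ^ m = (u * (u - 2 * x + x ^ 2)) ^ m := by rw [mul_pow]
      _ ≤ ((u - x) ^ 2 * Real.exp (x ^ 2 / (u - 1))) ^ m :=
          pow_le_pow_left₀ (by nlinarith [sq_nonneg x]) h1 _
      _ = Real.exp (m * x ^ 2 / (u - 1)) * ((u - x) ^ m) ^ 2 := by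
          rw [mul_pow, ← Real.exp_nat_mul, ← pow_mul, ← pow_mul, mul_comm 2 m]
          rw [mul_comm]; congr 2; ring
      _ ≤ r * ((u - x) ^ m) ^ 2 := by
          refine mul_le_mul_of_nonneg_right ?_ (sq_nonneg _)
          exact (Real.le_log_iff_exp_le hr0).1 hm
  have hkey2 : u ^ m * (u - 2 * x) ^ m ≤ ((u - x) ^ m) ^ 2 := by
    rw [← mul_pow, ← pow_mul, mul_comm m 2, pow_mul]
    exact pow_le_pow_left₀ (by nlinarith) (by nlinarith [sq_nonneg x]) _
  have hPZ := card_div_eight_le_of_second_moment V hpos (by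
    rw [hcard, hsum]
    calc u ^ m * ∑ S, V S ^ 2
        ≤ u ^ m * (r * (u - 2 * x + x ^ 2) ^ m + r * (r * (u - 2 * x) ^ m)) := by gcongr
      _ = r * (u ^ m * (u - 2 * x + x ^ 2) ^ m) + r * r * (u ^ m * (u - 2 * x) ^ m) := by ring
      _ ≤ r * (r * ((u - x) ^ m) ^ 2) + r * r * ((u - x) ^ m) ^ 2 := by gcongr
      _ = 2 * (r * (u - x) ^ m) ^ 2 := by ring)
  rw [hcard] at hPZ
  refine hPZ.trans ?_
  norm_cast
  refine Finset.card_le_card fun S hS => ?_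
  rw [Finset.mem_filter] at hS ⊢
  refine ⟨hS.1, ?_⟩
  have h1 := hS.2
  rw [hsum, hV] at h1
  by_contra! hcon
  have hne : B.Nonempty := Finset.card_pos.1 hB
  have h2 : ∑ y ∈ B, 2 * (1 - x) ^ occ S y < ∑ y ∈ B, (1 - x / u) ^ m :=
    Finset.sum_lt_sum_of_nonempty hne fun y hy => hcon y hy
  rw [← Finset.mul_sum, Finset.sum_const, nsmul_eq_mul, ← hr] at h2
  have h3 : r * (u - x) ^ m = u ^ m * (r * (1 - x / u) ^ m) := by
    rw [show u - x = u * (1 - x / u) by field_simp, mul_pow]; ring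
  have hum : 0 < u ^ m := by positivity
  nlinarith

end Occ

theorem occ_le_of_pow_le {m n : ℕ} {u x : ℝ} (hx0 : 0 < x) (hx1 : x < 1) (hu : 101 ≤ u)
    (hlam : 100 ≤ m / u * x ^ 2) (h : (1 - x / u) ^ m ≤ 2 * (1 - x) ^ n) :
    (n : ℝ) ≤ m / u * (1 - x / 4) := by
  set L := (m : ℝ) / u with hL
  have hu0 : 0 < u := by linarith
  have hy : 0 < 1 - x / u := by
    rw [sub_pos, div_lt_one hu0]; linarith
  have h1 : m * Real.log (1 - x / u) ≤ Real.log 2 + n * Real.log (1 - x) := by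
    have := Real.log_le_log (by positivity) h
    rwa [Real.log_pow, Real.log_mul (by norm_num) (pow_ne_zero _ (by linarith)),
      Real.log_pow] at this
  have h2 : x + x ^ 2 / 2 ≤ -Real.log (1 - x) := by
    have hs := Real.hasSum_pow_div_log_of_abs_lt_one (x := x) (by rw [abs_of_pos hx0]; exact hx1)
    have := sum_le_hasSum (Finset.range 2) (fun i _ => by positivity) hs
    norm_num [Finset.sum_range_succ] at this
    linarith
  have h3 : 1 - (1 - x / u)⁻¹ ≤ Real.log (1 - x / u) := Real.one_sub_inv_le_log_of_pos hy
  have h4 : (m : ℝ) * ((1 - x / u)⁻¹ - 1) ≤ L * (x + x ^ 2 / 100) := by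
    have h5 : (1 - x / u)⁻¹ - 1 = x / (u - x) := by
      have : u - x ≠ 0 := by linarith
      field_simp
      ring
    have h6 : (m : ℝ) = L * u := by rw [hL]; field_simp
    rw [h5, h6, mul_assoc]
    refine mul_le_mul_of_nonneg_left ?_ (by positivity)
    rw [mul_div_assoc', div_le_iff₀ (by linarith)]
    nlinarith [mul_pos hx0 hx0]
  have hlog2 : Real.log 2 ≤ 1 := by have := Real.log_two_lt_d9; linarith
  have h7 : (n : ℝ) * (x + x ^ 2 / 2) ≤ L * (x + x ^ 2 / 50) := by
    have h8 : (n : ℝ) * (x + x ^ 2 / 2) ≤ n * (-Real.log (1 - x)) := by gcongr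
    have h9 : (m : ℝ) * (1 - (1 - x / u)⁻¹) ≤ m * Real.log (1 - x / u) := by gcongr
    nlinarith
  have hL0 : 0 ≤ L := by positivity
  have h10 : (n : ℝ) * (x + x ^ 2 / 2) ≤ L * (1 - x / 4) * (x + x ^ 2 / 2) := by
    refine h7.trans ?_
    rw [mul_assoc]
    refine mul_le_mul_of_nonneg_left ?_ hL0
    nlinarith [mul_pos hx0 hx0, mul_pos (mul_pos hx0 hx0) (sub_pos.2 hx1)]
  exact le_of_mul_le_mul_right h10 (by positivity)

theorem card_div_sixteen_le_of_average {Ω J : Type*} [Fintype Ω] [Fintype J] (good : J → Ω → Prop)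
    [∀ j, DecidablePred (good j)]
    (h : ∀ j, (Fintype.card Ω : ℝ) / 8 ≤ (univ.filter (good j)).card)
    (hJ : 0 < Fintype.card J) :
    (Fintype.card Ω : ℝ) / 16 ≤ (univ.filter fun ω =>
      (Fintype.card J : ℝ) / 16 ≤ (univ.filter fun j => good j ω).card).card := by
  classical
  set d : ℝ := (Fintype.card J : ℝ) with hd
  have hd0 : 0 < d := by rw [hd]; exact_mod_cast hJ
  set T := univ.filter fun ω => d / 16 ≤ (univ.filter fun j => good j ω).card with hT
  have h1 : d * ((Fintype.card Ω : ℝ) / 8) ≤ ∑ ω, ((univ.filter fun j => good j ω).card : ℝ) := by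
    calc d * ((Fintype.card Ω : ℝ) / 8) = ∑ _j : J, (Fintype.card Ω : ℝ) / 8 := by simp [hd]
      _ ≤ ∑ j, ((univ.filter (good j)).card : ℝ) := Finset.sum_le_sum fun j _ => h j
      _ = _ := by
        simp_rw [Finset.card_filter]
        push_cast
        exact Finset.sum_comm
  have h2 : ∀ ω, ((univ.filter fun j => good j ω).card : ℝ)
      ≤ d / 16 + if ω ∈ T then d else 0 := by
    intro ω
    split_ifs with hω
    · have : ((univ.filter fun j => good j ω).card : ℝ) ≤ d := by
        rw [hd]; exact_mod_cast Finset.card_le_univ _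
      linarith
    · have : ¬ d / 16 ≤ ((univ.filter fun j => good j ω).card : ℝ) := by simpa [hT] using hω
      linarith
  have h3 := h1.trans (Finset.sum_le_sum fun ω _ => h2 ω)
  rw [Finset.sum_add_distrib, ← Finset.sum_filter, Finset.sum_const, Finset.sum_const] at h3
  simp only [Finset.filter_mem_eq_inter, Finset.univ_inter, nsmul_eq_mul, Finset.card_univ] at h3
  refine le_of_mul_le_mul_left ?_ hd0
  linarith

theorem card_div_sixteen_le_many_rare {J : Type*} [Fintype J] [DecidableEq J] {r m : ℕ} {lam : ℝ}
    (hJ : 0 < Fintype.card J) (hlam : lam = m / (Fintype.card J * r)) (hr : 200 ≤ Real.log r)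
    (hr' : Real.log r ≤ lam) :
    ((Fintype.card J * r : ℝ) ^ m) / 16 ≤ (univ.filter fun S : Fin m → J × Fin r =>
      (Fintype.card J : ℝ) / 16 ≤ (univ.filter fun j => ∃ s, (occ S (j, s) : ℝ)
        ≤ lam - Real.sqrt (lam * Real.log r / 2) / 4).card).card := by
  classical
  have hlam0 : 0 < lam := by linarith
  have hr0 : (0 : ℝ) < r := by
    rcases Nat.eq_zero_or_pos r with h | h
    · simp [h] at hr; norm_num at hr
    · exact_mod_cast h
  have hr1 : (201 : ℝ) ≤ r := by
    have := Real.log_le_sub_one_of_pos hr0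
    linarith
  have hJ' : (1 : ℝ) ≤ Fintype.card J := by exact_mod_cast hJ
  set x := Real.sqrt (Real.log r / (2 * lam)) with hx
  have hxsq : x ^ 2 = Real.log r / (2 * lam) := Real.sq_sqrt (by positivity)
  have hlx : lam * x ^ 2 = Real.log r / 2 := by rw [hxsq]; field_simp
  have hx0 : 0 < x := Real.sqrt_pos.2 (by positivity)
  have hx1 : x < 1 := by
    have : x ^ 2 < 1 := by rw [hxsq, div_lt_one (by positivity)]; linarith
    nlinarith
  have hlamx : Real.sqrt (lam * Real.log r / 2) = lam * x := by
    rw [← Real.sqrt_sq (by positivity : 0 ≤ lam * x)]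
    congr 1
    rw [mul_pow, sq lam, mul_assoc, hlx]; ring
  have hcardY : (Fintype.card (J × Fin r) : ℝ) = Fintype.card J * r := by simp
  have hu : (201 : ℝ) ≤ Fintype.card J * r := by nlinarith
  have hm : (m : ℝ) = lam * (Fintype.card J * r) := by
    rw [hlam]; field_simp
  have := card_div_sixteen_le_of_average (Ω := Fin m → J × Fin r) (J := J)
    (fun j S => ∃ s, (occ S (j, s) : ℝ) ≤ lam - Real.sqrt (lam * Real.log r / 2) / 4)
    (fun j => ?_) hJ
  · rw [Fintype.card_fun, Nat.cast_pow, hcardY, Fintype.card_fin] at this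
    exact this
  · have h1 := card_div_eight_le_exists_occ (m := m)
      (univ.image fun s : Fin r => ((j, s) : J × Fin r)) hx0 hx1
      (by rw [Finset.card_image_of_injective _ (Prod.mk_right_injective j), Finset.card_univ,
            Fintype.card_fin]; exact_mod_cast hr0)
      (by have : (2 : ℝ) ≤ Fintype.card (J × Fin r) := by rw [hcardY]; linarith
          exact_mod_cast this)
      (by
        rw [Finset.card_image_of_injective _ (Prod.mk_right_injective j), Finset.card_univ,
          Fintype.card_fin, hcardY, div_le_iff₀ (by linarith), hm]
        nlinarith)
    rw [Fintype.card_fun, Nat.cast_pow, Fintype.card_fin, hcardY] at *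
    refine h1.trans ?_
    norm_cast
    refine Finset.card_le_card fun S hS => ?_
    rw [Finset.mem_filter] at hS ⊢
    refine ⟨hS.1, ?_⟩
    obtain ⟨y, hy, hle⟩ := hS.2
    obtain ⟨s, -, rfl⟩ := Finset.mem_image.1 hy
    refine ⟨s, ?_⟩
    have h2 := occ_le_of_pow_le (m := m) hx0 hx1 (by linarith : 101 ≤ (Fintype.card J * r : ℝ))
      (by rw [← hlam, hlx]; linarith) (by exact_mod_cast hle)
    rw [← hlam] at h2
    rw [hlamx]
    refine h2.trans (le_of_eq ?_)
    ring

section UniformMap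

variable {X₀ A : Type*} [Fintype X₀] [Nonempty X₀] {φ : X₀ → A}

theorem uniformMap_apply (hφ : Function.Injective φ) (x : X₀) :
    (PMF.uniformOfFintype X₀).map φ (φ x) = (Fintype.card X₀ : ENNReal)⁻¹ := by
  classical
  rw [PMF.map_apply, tsum_eq_single x]
  · simp
  · intro y hy
    rw [if_neg fun h => hy (hφ h).symm]

theorem uniformMap_apply_of_notMem {p : A} (hp : p ∉ Set.range φ) :
    (PMF.uniformOfFintype X₀).map φ p = 0 := by
  classical
  rw [PMF.apply_eq_zero_iff, PMF.support_map]
  rintro ⟨x, -, rfl⟩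
  exact hp ⟨x, rfl⟩

theorem pmfPr_uniformMap (s : Set A) [DecidablePred fun x => φ x ∈ s] :
    pmfPr ((PMF.uniformOfFintype X₀).map φ) s
      = ((univ.filter fun x => φ x ∈ s).card : ℝ) / Fintype.card X₀ := by
  let _ : DecidablePred (· ∈ φ ⁻¹' s) := inferInstanceAs (DecidablePred fun x => φ x ∈ s)
  rw [pmfPr, PMF.toOuterMeasure_map_apply, PMF.toOuterMeasure_uniformOfFintype_apply,
    ENNReal.toReal_div, ENNReal.toReal_natCast, ENNReal.toReal_natCast]
  congr 2
  exact Fintype.card_subtype _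

theorem samplePr_uniformMap (hφ : Function.Injective φ) (m : ℕ) (E : Set (Fin m → A))
    [DecidablePred fun S : Fin m → X₀ => φ ∘ S ∈ E] :
    samplePr ((PMF.uniformOfFintype X₀).map φ) m E
      = ((univ.filter fun S : Fin m → X₀ => φ ∘ S ∈ E).card : ℝ)
        / (Fintype.card X₀ : ℝ) ^ m := by
  classical
  set D := (PMF.uniformOfFintype X₀).map φ
  have hinj : Function.Injective fun S : Fin m → X₀ => φ ∘ S := hφ.comp_left
  have hsupp : Function.support (E.indicator fun S => ∏ j, D (S j))
      ⊆ Set.range fun S : Fin m → X₀ => φ ∘ S := by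
    intro S hS
    have h1 : ∏ j, D (S j) ≠ 0 := fun h => hS (by
      by_cases hE : S ∈ E <;> simp [hE, h])
    have h2 : ∀ j, S j ∈ Set.range φ := fun j => by
      by_contra h
      exact h1 (Finset.prod_eq_zero (Finset.mem_univ j) (uniformMap_apply_of_notMem h))
    choose T hT using h2
    exact ⟨T, funext hT⟩
  rw [samplePr, ← hinj.tsum_eq hsupp, tsum_fintype]
  have h3 : ∀ S : Fin m → X₀, E.indicator (fun S => ∏ j, D (S j)) (φ ∘ S)
      = if φ ∘ S ∈ E then ((Fintype.card X₀ : ENNReal)⁻¹) ^ m else 0 := by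
    intro S
    rw [Set.indicator_apply]
    congr 1
    simp [D, uniformMap_apply hφ]
  simp_rw [h3]
  rw [← Finset.sum_filter, Finset.sum_const, nsmul_eq_mul, ENNReal.toReal_mul,
    ENNReal.toReal_natCast, ENNReal.toReal_pow, ENNReal.toReal_inv, ENNReal.toReal_natCast,
    inv_pow, div_eq_mul_inv]

end UniformMap

/-- Realises a finite indexed family of sign functions as a class of base learners of the same
cardinality, and transfers a counting bound to the uniform distribution. -/
theorem exists_class_of_family {X₀ I : Type} [Fintype X₀] [Nonempty X₀] [Fintype I]
    (hyp : I → X₀ → ℝ) (hyp_sign : ∀ i x, hyp i x = 1 ∨ hyp i x = -1) {m : ℕ} {θ τ δ : ℝ}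
    (good : Finset (Fin m → X₀))
    (hgood : ∀ S ∈ good, ∃ w : I → ℝ, (∀ i, 0 ≤ w i) ∧ ∑ i, w i = 1 ∧
      (Nat.card {j // ∑ i, w i * hyp i (S j) ≤ θ} : ℝ) / m ≤ τ ∧
      (Nat.card {j // ∑ i, w i * hyp i (S j) ≤ θ} : ℝ) / m + δ
        ≤ (Nat.card {x // ∑ i, w i * hyp i x ≤ 0} : ℝ) / Fintype.card X₀)
    (hcard : (Fintype.card X₀ : ℝ) ^ m / 100 ≤ good.card) :
    ∃ (X : Type) (H : Finset (X → ℝ)) (D : PMF (X × ℝ)),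
      (∀ h ∈ H, ∀ x, h x = 1 ∨ h x = -1) ∧
      (∀ p ∈ D.support, p.2 = 1 ∨ p.2 = -1) ∧ H.card = Fintype.card I ∧
      1 / 100 ≤ samplePr D m {S : Fin m → X × ℝ |
        ∃ α : (X → ℝ) → ℝ, (∀ h ∈ H, 0 ≤ α h) ∧ (∑ h ∈ H, α h = 1) ∧
          empLoss S (vote H α) θ ≤ τ ∧
          empLoss S (vote H α) θ + δ ≤ pmfPr D {p : X × ℝ | p.2 * vote H α p.1 ≤ 0}} := by
  classical
  let hyp' : I → (X₀ ⊕ I) → ℝ := fun i => Sum.elim (hyp i) fun j => if j = i then -1 else 1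
  have hinj : Function.Injective hyp' := by
    intro i j hij
    have h1 := congrFun hij (Sum.inr i)
    by_contra hne
    norm_num [hyp', hne] at h1
  let φ : X₀ → (X₀ ⊕ I) × ℝ := fun x => (Sum.inl x, 1)
  have hφ : Function.Injective φ := fun x y h => Sum.inl_injective (Prod.ext_iff.1 h).1
  refine ⟨X₀ ⊕ I, univ.map ⟨hyp', hinj⟩, (PMF.uniformOfFintype X₀).map φ, ?_, ?_, ?_, ?_⟩
  · intro h hh x
    obtain ⟨i, -, rfl⟩ := Finset.mem_map.1 hh
    rcases x with x | j
    · exact hyp_sign i x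
    · by_cases hji : j = i <;> simp [hyp', hji]
  · intro p hp
    rw [PMF.support_map] at hp
    obtain ⟨x, -, rfl⟩ := hp
    exact Or.inl rfl
  · simp
  · have hpos : (0 : ℝ) < (Fintype.card X₀ : ℝ) ^ m := by
      have : 0 < Fintype.card X₀ := Fintype.card_pos
      positivity
    rw [samplePr_uniformMap hφ, le_div_iff₀ hpos]
    refine le_trans (le_of_eq (by ring)) (hcard.trans ?_)
    norm_cast
    refine Finset.card_le_card fun S hS => ?_
    rw [Finset.mem_filter]
    refine ⟨Finset.mem_univ _, ?_⟩
    obtain ⟨w, hw0, hw1, hw2, hw3⟩ := hgood S hS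
    have happ : ∀ i, Function.extend hyp' w 0 (hyp' i) = w i := fun i => hinj.extend_apply _ _ _
    have hvote : ∀ x, vote (univ.map ⟨hyp', hinj⟩) (Function.extend hyp' w 0) (Sum.inl x)
        = ∑ i, w i * hyp i x := by
      intro x
      simp only [vote, Finset.sum_map, Function.Embedding.coeFn_mk, happ]
      rfl
    have hemp : empLoss (φ ∘ S) (vote (univ.map ⟨hyp', hinj⟩) (Function.extend hyp' w 0)) θ
        = (Nat.card {j // ∑ i, w i * hyp i (S j) ≤ θ} : ℝ) / m := by
      simp [empLoss, φ, hvote]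
    refine ⟨Function.extend hyp' w 0, ?_, ?_, ?_, ?_⟩
    · intro h hh
      obtain ⟨i, -, rfl⟩ := Finset.mem_map.1 hh
      exact (hw0 i).trans_eq (happ i).symm
    · simpa only [Finset.sum_map, Function.Embedding.coeFn_mk, happ] using hw1
    · rw [hemp]; exact hw2
    · rw [hemp, pmfPr_uniformMap]
      refine hw3.trans (le_of_eq ?_)
      congr 2
      simp [φ, hvote, Nat.card_eq_fintype_card, Fintype.card_subtype]

theorem card_filter_mem_le_mul {Y : Type*} [DecidableEq Y] {m : ℕ} (S : Fin m → Y) (T : Finset Y)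
    {c : ℝ} (h : ∀ y ∈ T, (occ S y : ℝ) ≤ c) :
    ((univ.filter fun i => S i ∈ T).card : ℝ) ≤ T.card * c := by
  rw [Finset.card_eq_sum_card_fiberwise (t := T) (f := S) fun i hi => by simpa using hi]
  push_cast
  rw [← nsmul_eq_mul]
  refine Finset.sum_le_card_nsmul _ _ _ fun y hy => le_trans ?_ (h y hy)
  exact_mod_cast Finset.card_le_card fun i hi => by
    simp only [Finset.mem_filter] at hi ⊢
    exact ⟨Finset.mem_univ _, hi.2⟩

theorem exists_hard_class {k q r m n K : ℕ} {θ τ lam G δ : ℝ} (hk : 0 < k) (hq : 0 < q)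
    (hn : n ≠ 0) (hqn : q ≤ 2 ^ n) (hr : r ≤ (2 ^ n) ^ K) (hK : 2 * K ≤ 2 ^ n)
    (hG1 : G ≤ 1) (hGq : 4 * G ^ 2 * q ≤ 1) (hθ : 0 ≤ θ) (hθG : 4 * θ < G)
    (hlam : lam = m / (k * q * r)) (hr200 : 200 ≤ Real.log r) (hrlam : Real.log r ≤ lam)
    (hτ : 1 / r ≤ τ) (hδ : δ ≤ k * q / 16 * (Real.sqrt (lam * Real.log r / 2) / 4) / m) :
    ∃ (X : Type) (H : Finset (X → ℝ)) (D : PMF (X × ℝ)),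
      (∀ h ∈ H, ∀ x, h x = 1 ∨ h x = -1) ∧
      (∀ p ∈ D.support, p.2 = 1 ∨ p.2 = -1) ∧ H.card = 2 ^ k * (2 ^ n) ^ 4 + 1 ∧
      1 / 100 ≤ samplePr D m {S : Fin m → X × ℝ |
        ∃ α : (X → ℝ) → ℝ, (∀ h ∈ H, 0 ≤ α h) ∧ (∑ h ∈ H, α h = 1) ∧
          empLoss S (vote H α) θ ≤ τ ∧
          empLoss S (vote H α) θ + δ
            ≤ pmfPr D {p : X × ℝ | p.2 * vote H α p.1 ≤ 0}} := by
  classical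
  let F := GaloisField 2 n
  let _ : Fintype F := Fintype.ofFinite F
  have hF : Fintype.card F = 2 ^ n := by
    rw [← Nat.card_eq_fintype_card]; exact GaloisField.card 2 n hn
  obtain ⟨ψ, hψ⟩ := exists_isSignChar F
  obtain ⟨e⟩ : Nonempty (Fin q ↪ F) :=
    Function.Embedding.nonempty_of_card_le (by simpa [hF] using hqn)
  have hG0 : 0 < G := by linarith
  obtain ⟨hyp, hyp_sign, hyp_t⟩ := exists_transversal_system (r := r) (K := K) (κ := Fin k) hψ e.injective hG0.le
    (by simpa using hGq) (by rwa [hF]) (by rwa [hF])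
  set Δ := Real.sqrt (lam * Real.log r / 2) / 4 with hΔ
  have hΔ0 : 0 ≤ Δ := by positivity
  have hlam0 : 0 < lam := by linarith
  have hr0 : 0 < r := by
    rcases Nat.eq_zero_or_pos r with h | h
    · simp [h] at hr200; norm_num at hr200
    · exact h
  have hm0 : (0 : ℝ) < m := by
    rcases Nat.eq_zero_or_pos m with h | h
    · rw [hlam, h] at hlam0; simp at hlam0
    · exact_mod_cast h
  have : Nonempty (Fin k) := ⟨⟨0, hk⟩⟩
  have : Nonempty (Fin q) := ⟨⟨0, hq⟩⟩
  have : Nonempty (Fin r) := ⟨⟨0, hr0⟩⟩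
  have hkR : (0 : ℝ) < k := by exact_mod_cast hk
  have hqR : (0 : ℝ) < q := by exact_mod_cast hq
  have hrR : (0 : ℝ) < r := by exact_mod_cast hr0
  have hJ : Fintype.card (Fin k × Fin q) = k * q := by simp
  have hrare := card_div_sixteen_le_many_rare (J := Fin k × Fin q) (r := r) (m := m) (lam := lam)
    (by rw [hJ]; positivity) (by rw [hJ, hlam]; push_cast; rfl) hr200 hrlam
  rw [← hΔ] at hrare
  have hX : (Fintype.card ((Fin k × Fin q) × Fin r) : ℝ) = k * q * r := by simp
  have hclass := exists_class_of_family
    (I := Option ((F × F) × ((Fin k → Bool) × F × F)))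
    (fun i x => i.elim 1 fun i => hyp i x) (m := m) (θ := θ) (τ := τ)
    (δ := δ)
    (fun i x => by rcases i with _ | i <;> simp [hyp_sign]) _ (fun S hS => ?_)
    (le_trans (by rw [hJ, hX]; push_cast; gcongr; norm_num) hrare)
  · obtain ⟨X, H, D, h1, h2, h3, h4⟩ := hclass
    refine ⟨X, H, D, h1, h2, ?_, h4⟩
    rw [h3, Fintype.card_option]
    simp [hF]
    ring
  · have hmany := (Finset.mem_filter.1 hS).2
    let t : Fin k × Fin q → Option (Fin r) := fun j =>
      if h : ∃ s, (occ S (j, s) : ℝ) ≤ lam - Δ then some h.choose else none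
    have ht : ∀ j s, t j = some s → (occ S (j, s) : ℝ) ≤ lam - Δ := by
      intro j s hjs
      by_cases h : ∃ s, (occ S (j, s) : ℝ) ≤ lam - Δ
      · simp only [t, dif_pos h, Option.some.injEq] at hjs
        exact hjs ▸ h.choose_spec
      · simp [t, dif_neg h] at hjs
    have ht' : ∀ j, (∃ s, (occ S (j, s) : ℝ) ≤ lam - Δ) → ∃ s, t j = some s := fun j h =>
      ⟨h.choose, by simp only [t, dif_pos h]⟩
    obtain ⟨w, hw0, hw1, hw2⟩ := hyp_t t
    set T : Finset ((Fin k × Fin q) × Fin r) := univ.filter fun x => t x.1 = some x.2 with hT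
    have hTlow : (k * q / 16 : ℝ) ≤ T.card := by
      refine le_trans (by rw [hJ]; push_cast; rfl) (hmany.trans ?_)
      norm_cast
      refine (Finset.card_le_card (t := T.image Prod.fst) fun j hj => ?_).trans
        Finset.card_image_le
      obtain ⟨s, hs⟩ := ht' j (Finset.mem_filter.1 hj).2
      exact Finset.mem_image.2 ⟨(j, s), by simp [hT, hs], rfl⟩
    have hTup : (T.card : ℝ) ≤ k * q := by
      have hinj : Set.InjOn Prod.fst (T : Set ((Fin k × Fin q) × Fin r)) := by
        rintro ⟨j, s⟩ hx ⟨j', s'⟩ hy hxy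
        simp only [hT, Finset.coe_filter, Finset.mem_univ, true_and, Set.mem_ofPred_eq] at hx hy hxy
        subst hxy
        rw [hx, Option.some.injEq] at hy
        rw [hy]
      have := Finset.card_le_univ (T.image Prod.fst)
      rw [Finset.card_image_of_injOn hinj, hJ] at this
      exact_mod_cast this
    set w' : Option ((F × F) × ((Fin k → Bool) × F × F)) → ℝ :=
      fun i => i.elim (G / (1 + G)) fun i => w i / (1 + G) with hw'
    have hval : ∀ x, ∑ i, w' i * (i.elim 1 fun i => hyp i x)
        = (G + ∑ i, w i * hyp i x) / (1 + G) := by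
      intro x
      rw [Fintype.sum_option, add_div, Finset.sum_div]
      simp only [hw', Option.elim, mul_one]
      congr 1
      exact Finset.sum_congr rfl fun i _ => by ring
    have hval0 : ∀ x, x ∈ T → ∑ i, w' i * (i.elim 1 fun i => hyp i x) = 0 := by
      intro x hx
      rw [hval, (hw2 x).1 (by simpa [hT] using hx)]; simp
    have hvalpos : ∀ x, x ∉ T → θ < ∑ i, w' i * (i.elim 1 fun i => hyp i x) := by
      intro x hx
      rw [hval, lt_div_iff₀ (by linarith)]
      have := (hw2 x).2 (by simpa [hT] using hx)
      nlinarith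
    have hle : ∀ x, ∀ c, 0 ≤ c → c ≤ θ →
        (∑ i, w' i * (i.elim 1 fun i => hyp i x) ≤ c ↔ x ∈ T) := by
      intro x c hc0 hcθ
      refine ⟨fun h => ?_, fun h => (hval0 x h).trans_le hc0⟩
      by_contra hx
      linarith [hvalpos x hx]
    refine ⟨w', ?_, ?_, ?_⟩
    · rintro (_ | i)
      · exact div_nonneg hG0.le (by linarith)
      · exact div_nonneg (hw0 i) (by linarith)
    · rw [Fintype.sum_option]
      simp only [hw', Option.elim]
      rw [← Finset.sum_div, hw1]
      field_simp
      ring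
    · simp_rw [hle _ θ hθ le_rfl, hle _ 0 le_rfl hθ, hX]
      have hc1 : Nat.card {j // S j ∈ T} = (univ.filter fun i => S i ∈ T).card := by
        rw [Nat.card_eq_fintype_card, Fintype.card_subtype]
      have hc2 : Nat.card {x // x ∈ T} = T.card := by
        rw [Nat.card_eq_fintype_card, Fintype.card_coe]
      rw [hc1, hc2]
      have hocc := card_filter_mem_le_mul S T (c := lam - Δ) fun y hy =>
        ht y.1 y.2 (by simpa [hT] using hy)
      have hTu : (T.card : ℝ) / (k * q * r) = T.card * lam / m := by
        rw [hlam]; field_simp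
      have hgap : ((univ.filter fun i => S i ∈ T).card : ℝ) / m + k * q / 16 * Δ / m
          ≤ (T.card : ℝ) / (k * q * r) := by
        rw [hTu, ← add_div]
        gcongr
        linarith [mul_le_mul_of_nonneg_right hTlow hΔ0]
      have hδ0 : 0 ≤ k * q / 16 * Δ / m := by positivity
      have hT1 : (T.card : ℝ) / (k * q * r) ≤ 1 / r := by
        rw [div_le_div_iff₀ (by positivity) hrR, one_mul]
        gcongr
      exact ⟨by linarith, by linarith⟩

theorem log_card_bounds {N k n : ℕ} (hN : 32 ≤ N) (hk : (k : ℝ) ≤ Real.log N)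
    (h1 : N ^ 2 ≤ 2 ^ n) (h2 : 2 ^ n ≤ 2 * N ^ 2) :
    Real.log N ≤ Real.log ((2 ^ k * (2 ^ n) ^ 4 + 1 : ℕ) : ℝ) ∧
      Real.log ((2 ^ k * (2 ^ n) ^ 4 + 1 : ℕ) : ℝ) ≤ 10 * Real.log N := by
  have hN0 : (0 : ℝ) < N := by positivity
  have hkN : 2 ^ k ≤ N := by
    have : (2 : ℝ) ^ k ≤ N := by
      calc (2 : ℝ) ^ k ≤ Real.exp 1 ^ k := by
            gcongr; linarith [Real.add_one_le_exp 1]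
        _ = Real.exp k := by rw [← Real.exp_nat_mul, mul_one]
        _ ≤ Real.exp (Real.log N) := Real.exp_le_exp.2 hk
        _ = N := Real.exp_log hN0
    exact_mod_cast this
  constructor
  · refine Real.log_le_log hN0 ?_
    have : N ≤ 2 ^ k * (2 ^ n) ^ 4 + 1 :=
      calc N ≤ N ^ 2 := Nat.le_self_pow two_ne_zero N
        _ ≤ 2 ^ n := h1
        _ ≤ (2 ^ n) ^ 4 := Nat.le_self_pow four_ne_zero _
        _ ≤ 2 ^ k * (2 ^ n) ^ 4 := Nat.le_mul_of_pos_left _ (by positivity)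
        _ ≤ _ := Nat.le_succ _
    exact_mod_cast this
  · have : 2 ^ k * (2 ^ n) ^ 4 + 1 ≤ N ^ 10 :=
      calc 2 ^ k * (2 ^ n) ^ 4 + 1 ≤ 2 ^ k * (2 ^ n) ^ 4 + 2 ^ k * (2 ^ n) ^ 4 := by
            gcongr; exact Nat.one_le_iff_ne_zero.2 (by positivity)
        _ = 2 * (2 ^ k * (2 ^ n) ^ 4) := by ring
        _ ≤ 2 * (N * (2 * N ^ 2) ^ 4) := by gcongr
        _ = 32 * N ^ 9 := by ring
        _ ≤ N * N ^ 9 := by gcongr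
        _ = N ^ 10 := by ring
    calc _ ≤ Real.log ((N : ℝ) ^ 10) :=
          Real.log_le_log (by positivity) (by exact_mod_cast this)
      _ = 10 * Real.log N := by rw [Real.log_pow]; norm_num

theorem mul_log_one_div_le {x y : ℝ} (hx : 0 < x) (hxy : x ≤ y) (hy : y ≤ Real.exp (-1)) :
    x * Real.log (1 / x) ≤ y * Real.log (1 / y) := by
  have hy0 := hx.trans_le hxy
  have key : ∀ {z : ℝ}, 0 < z → z ≤ Real.exp (-1) → Real.exp 1 ≤ 1 / z := fun hz h => by
    rw [le_div_iff₀ hz]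
    calc Real.exp 1 * _ ≤ Real.exp 1 * Real.exp (-1) := by gcongr
      _ = 1 := by rw [← Real.exp_add]; simp
  have := Real.log_div_self_antitoneOn (key hy0 hy) (key hx (hxy.trans hy))
    (one_div_le_one_div_of_le hx hxy)
  simpa [mul_comm] using this

theorem mul_log_one_div_le_one {x : ℝ} (hx : 0 < x) : x * Real.log (1 / x) ≤ 1 := by
  have := Real.log_le_sub_one_of_pos (one_div_pos.2 hx)
  calc x * Real.log (1 / x) ≤ x * (1 / x - 1) := by gcongr
    _ = 1 - x := by field_simp
    _ ≤ 1 := by linarith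

theorem mul_log_one_div_le_exp_mul_min {τ : ℝ} (hτ : 0 < τ) :
    τ * Real.log (1 / τ) ≤ Real.exp 200 *
      (min τ (Real.exp (-200)) * Real.log (1 / min τ (Real.exp (-200)))) := by
  rcases le_total τ (Real.exp (-200)) with h | h
  · rw [min_eq_left h]
    refine le_mul_of_one_le_left (mul_nonneg hτ.le (Real.log_nonneg ?_))
      (Real.one_le_exp (by norm_num))
    rw [le_div_iff₀ hτ, one_mul]
    exact h.trans (Real.exp_le_one_iff.2 (by norm_num))
  · rw [min_eq_right h, ← mul_assoc, ← Real.exp_add, one_div (Real.exp _), ← Real.exp_neg]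
    refine (mul_log_one_div_le_one hτ).trans ?_
    norm_num

theorem exists_forall_log_le_rpow {a : ℝ} (ha : 0 < a) :
    ∃ M : ℝ, ∀ m : ℝ, M ≤ m → Real.log m ≤ m ^ (a / (2 * (1 + a))) ∧
      m ^ (-(a / (2 * (1 + a)))) ≤ Real.exp (-200) := by
  have hκ : 0 < a / (2 * (1 + a)) := by positivity
  have h1 := (isLittleO_log_rpow_atTop hκ).bound one_pos
  have h2 := (tendsto_rpow_neg_atTop hκ).eventually (eventually_le_nhds (Real.exp_pos (-200)))
  obtain ⟨M, hM⟩ := Filter.eventually_atTop.1 ((h1.and h2).and (Filter.eventually_ge_atTop 0))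
  refine ⟨M, fun m hm => ⟨?_, (hM m hm).1.2⟩⟩
  have := (hM m hm).1.1
  rw [one_mul, Real.norm_of_nonneg (Real.rpow_nonneg (hM m hm).2 _)] at this
  exact (le_abs_self _).trans this

/-- For `B = ln N / θ²`, the quantity `B ln m / m` is polynomially small in `m`. -/
theorem mul_log_div_le_rpow_neg {a B m : ℝ} (ha : 0 < a) (hB : 0 ≤ B) (hm : 1 ≤ m)
    (hBm : B ^ (1 + a) ≤ m) (hlog : Real.log m ≤ m ^ (a / (2 * (1 + a)))) :
    B * Real.log m / m ≤ m ^ (-(a / (2 * (1 + a)))) := by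
  have hm0 : 0 < m := by linarith
  have hB' : B ≤ m ^ (1 / (1 + a)) := by
    rw [one_div, Real.le_rpow_inv_iff_of_pos hB hm0.le (by linarith)]
    exact hBm
  rw [div_le_iff₀ hm0]
  calc B * Real.log m ≤ m ^ (1 / (1 + a)) * m ^ (a / (2 * (1 + a))) := by
        have := Real.log_nonneg hm
        gcongr
    _ = m ^ (-(a / (2 * (1 + a)))) * m := by
        rw [← Real.rpow_add hm0]
        nth_rewrite 3 [← Real.rpow_one m]
        rw [← Real.rpow_add hm0]
        congr 1
        field_simp
        ring

theorem margin_gap_lower_bound {k q r m L θ t lam : ℝ} (hm : 0 < m) (hL : 0 < L) (hθ : 0 < θ)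
    (ht : 0 < t) (ht1 : t ≤ 1) (hk : L / 2 ≤ k) (hq : 1 / (200 * θ ^ 2) ≤ q) (hr : 1 / t ≤ r)
    (hr' : r ≤ 2 / t) (hlam : lam = m / (k * q * r)) :
    Real.sqrt (L / (m * θ ^ 2) * (t * Real.log (1 / t))) / 2560 ≤
      k * q / 16 * (Real.sqrt (lam * Real.log r / 2) / 4) / m := by
  have hk0 : 0 < k := by linarith [half_pos hL]
  have hq0 : 0 < q := lt_of_lt_of_le (by positivity) hq
  have hr0 : 0 < r := lt_of_lt_of_le (by positivity) hr
  have hlogt : 0 ≤ Real.log (1 / t) := Real.log_nonneg (by rwa [le_div_iff₀ ht, one_mul])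
  have hlog : Real.log (1 / t) ≤ Real.log r := Real.log_le_log (by positivity) hr
  have hd : L / (400 * θ ^ 2) ≤ k * q := by
    calc L / (400 * θ ^ 2) = L / 2 * (1 / (200 * θ ^ 2)) := by field_simp; norm_num
      _ ≤ k * q := by gcongr
  have hlhs : Real.sqrt (L / (m * θ ^ 2) * (t * Real.log (1 / t))) / 2560 =
      Real.sqrt (L / (400 * θ ^ 2) * Real.log (1 / t) / (8192 * m) * (t / 2)) := by
    rw [show L / (400 * θ ^ 2) * Real.log (1 / t) / (8192 * m) * (t / 2) =
      L / (m * θ ^ 2) * (t * Real.log (1 / t)) / 2560 ^ 2 by field_simp; ring,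
      Real.sqrt_div (by positivity), Real.sqrt_sq (by norm_num)]
  have hrhs : k * q / 16 * (Real.sqrt (lam * Real.log r / 2) / 4) / m =
      Real.sqrt (k * q * Real.log r / (8192 * m) * (1 / r)) := by
    rw [show k * q * Real.log r / (8192 * m) * (1 / r) =
      (k * q / (64 * m)) ^ 2 * (lam * Real.log r / 2) by rw [hlam]; field_simp; ring,
      Real.sqrt_mul (by positivity), Real.sqrt_sq (by positivity)]
    field_simp
    ring
  rw [hlhs, hrhs]
  refine Real.sqrt_le_sqrt ?_
  have : t / 2 ≤ 1 / r := by
    rw [le_div_iff₀ hr0]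
    rw [le_div_iff₀ ht] at hr'
    linarith
  have := hlogt.trans hlog
  gcongr

theorem complexity_terms_le_sqrt {ℓ L θ m t τ κ : ℝ} (hL : 0 < L) (hθ : 0 < θ) (hm : 1 < m)
    (hκ : 0 < κ) (hτ : 0 < τ) (ht : t = min τ (Real.exp (-200)))
    (hA : L * Real.log m / (m * θ ^ 2) ≤ t) (hAm : L * Real.log m / (m * θ ^ 2) ≤ m ^ (-κ))
    (hℓ0 : 0 ≤ ℓ) (hℓ : ℓ ≤ 10 * L) :
    ℓ * Real.log m / (m * θ ^ 2) + Real.sqrt (τ * Real.log (1 / τ) * ℓ / (m * θ ^ 2)) ≤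
      (10 / Real.sqrt κ + Real.sqrt (10 * Real.exp 200)) *
        Real.sqrt (L / (m * θ ^ 2) * (t * Real.log (1 / t))) := by
  have hm0 : 0 < m := by linarith
  have hlog : 0 < Real.log m := Real.log_pos hm
  have hte : t ≤ Real.exp (-200) := ht ▸ min_le_right _ _
  have ht0 : 0 < t := ht ▸ lt_min hτ (Real.exp_pos _)
  have hT0 : 0 ≤ t * Real.log (1 / t) := by
    refine mul_nonneg ht0.le (Real.log_nonneg ?_)
    rw [le_div_iff₀ ht0, one_mul]
    exact hte.trans (Real.exp_le_one_iff.2 (by norm_num))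
  set T := t * Real.log (1 / t) with hT
  set A := L * Real.log m / (m * θ ^ 2) with hAdef
  set B := L / (m * θ ^ 2) with hBdef
  have hB0 : 0 < B := by positivity
  have hAB : A = B * Real.log m := by rw [hAdef, hBdef]; ring
  have hA0 : 0 < A := by positivity
  have hlogA : κ * Real.log m ≤ Real.log (1 / A) := by
    have := Real.log_le_log hA0 hAm
    rw [Real.log_rpow hm0] at this
    rw [one_div, Real.log_inv]
    linarith
  have hAT : A * Real.log (1 / A) ≤ T :=
    mul_log_one_div_le hA0 hA (hte.trans (Real.exp_le_exp.2 (by norm_num)))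
  have hAR : A ≤ Real.sqrt (B * T) / Real.sqrt κ := by
    rw [← Real.sqrt_div (by positivity)]
    refine Real.le_sqrt_of_sq_le ?_
    rw [le_div_iff₀ hκ]
    calc A ^ 2 * κ = B * (A * (κ * Real.log m)) := by rw [sq]; nth_rewrite 1 [hAB]; ring
      _ ≤ B * (A * Real.log (1 / A)) := by gcongr
      _ ≤ B * T := by gcongr
  have h1 : ℓ * Real.log m / (m * θ ^ 2) ≤ 10 * A := by
    calc ℓ * Real.log m / (m * θ ^ 2) ≤ 10 * L * Real.log m / (m * θ ^ 2) := by gcongr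
      _ = 10 * A := by rw [hAdef]; ring
  have h2 : Real.sqrt (τ * Real.log (1 / τ) * ℓ / (m * θ ^ 2)) ≤
      Real.sqrt (10 * Real.exp 200) * Real.sqrt (B * T) := by
    rw [← Real.sqrt_mul (by positivity)]
    refine Real.sqrt_le_sqrt ?_
    have hmin := mul_log_one_div_le_exp_mul_min hτ
    rw [← ht, ← hT] at hmin
    calc τ * Real.log (1 / τ) * ℓ / (m * θ ^ 2)
        ≤ Real.exp 200 * T * (10 * L) / (m * θ ^ 2) := by gcongr
      _ = 10 * Real.exp 200 * (B * T) := by rw [hBdef]; ring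
  calc _ ≤ 10 * (Real.sqrt (B * T) / Real.sqrt κ) +
        Real.sqrt (10 * Real.exp 200) * Real.sqrt (B * T) := by linarith
    _ = _ := by ring

theorem half_le_natFloor {x : ℝ} (hx : 1 ≤ x) : x / 2 ≤ ⌊x⌋₊ := by
  have h1 : (1 : ℝ) ≤ ⌊x⌋₊ := by exact_mod_cast (Nat.one_le_floor_iff x).2 hx
  linarith [Nat.lt_floor_add_one x]

/-- Choice of the parameters of `exists_hard_class`, given that `ln N · ln m / (m θ²)` is small. -/
theorem exists_hard_class_of_small {N m : ℕ} {θ τ t : ℝ} (hN : 32 ≤ N) (hL1 : 1 ≤ Real.log N)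
    (hθN : 1 / (N : ℝ) < θ) (hθ : θ < 1 / 40) (hm2 : 3 ≤ m) (hmN : m ≤ 2 ^ N)
    (ht : t = min τ (Real.exp (-200))) (hA : Real.log N * Real.log m / (m * θ ^ 2) ≤ t) :
    ∃ c : ℕ, Real.log N ≤ Real.log c ∧ Real.log c ≤ 10 * Real.log N ∧
      ∀ δ : ℝ, δ ≤ Real.sqrt (Real.log N / (m * θ ^ 2) * (t * Real.log (1 / t))) / 2560 →
    ∃ (X : Type) (H : Finset (X → ℝ)) (D : PMF (X × ℝ)),
      (∀ h ∈ H, ∀ x, h x = 1 ∨ h x = -1) ∧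
      (∀ p ∈ D.support, p.2 = 1 ∨ p.2 = -1) ∧ H.card = c ∧
      1 / 100 ≤ samplePr D m {S : Fin m → X × ℝ |
        ∃ α : (X → ℝ) → ℝ, (∀ h ∈ H, 0 ≤ α h) ∧ (∑ h ∈ H, α h = 1) ∧
          empLoss S (vote H α) θ ≤ τ ∧
          empLoss S (vote H α) θ + δ ≤ pmfPr D {p : X × ℝ | p.2 * vote H α p.1 ≤ 0}} := by
  have hN0 : (0 : ℝ) < N := by positivity
  have hθ0 : 0 < θ := lt_trans (by positivity) hθN
  have hm3 : (3 : ℝ) ≤ m := by exact_mod_cast hm2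
  have hm0 : (0 : ℝ) < m := by linarith
  have hlogm : 1 ≤ Real.log m := by
    rw [Real.le_log_iff_exp_le hm0]
    linarith [Real.exp_one_lt_d9]
  set L := Real.log N with hLdef
  set A := L * Real.log m / (m * θ ^ 2) with hAdef
  have hA0 : 0 < A := by positivity
  have ht0 : 0 < t := hA0.trans_le hA
  have hte : t ≤ Real.exp (-200) := ht ▸ min_le_right _ _
  have ht1 : t ≤ 1 := hte.trans (Real.exp_le_one_iff.2 (by norm_num))
  have hAm : 1 / A ≤ m := by
    rw [hAdef, one_div_div, div_le_iff₀ (by positivity)]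
    have : θ ^ 2 ≤ L * Real.log m := by nlinarith
    gcongr
  set k := ⌊L⌋₊ with hkdef
  set q := ⌊1 / (100 * θ ^ 2)⌋₊ with hqdef
  set r := ⌈1 / t⌉₊ with hrdef
  have hk1 : L / 2 ≤ k := half_le_natFloor hL1
  have hk2 : (k : ℝ) ≤ L := Nat.floor_le (by linarith)
  have hq1 : 1 / (200 * θ ^ 2) ≤ q := by
    have : (1 : ℝ) ≤ 1 / (100 * θ ^ 2) := by
      rw [le_div_iff₀ (by positivity)]; nlinarith
    refine le_trans (le_of_eq ?_) (half_le_natFloor this)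
    field_simp
    norm_num
  have hq2 : (q : ℝ) ≤ 1 / (100 * θ ^ 2) := Nat.floor_le (by positivity)
  have hr1 : 1 / t ≤ r := Nat.le_ceil _
  have h1t : 1 ≤ 1 / t := by rwa [le_div_iff₀ ht0, one_mul]
  have hr2 : (r : ℝ) ≤ 2 / t := by
    have := Nat.ceil_lt_add_one (a := 1 / t) (by positivity)
    rw [show 2 / t = 1 / t + 1 / t by ring]
    linarith
  have hk0 : (0 : ℝ) < k := by linarith
  have hq0 : (0 : ℝ) < q := lt_of_lt_of_le (by positivity) hq1
  have hr0 : (0 : ℝ) < r := by linarith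
  have hrm : (r : ℝ) ≤ 2 * m := by
    have : 1 / t ≤ 1 / A := one_div_le_one_div_of_le hA0 hA
    rw [show 2 / t = 1 / t + 1 / t by ring] at hr2
    linarith
  set p := Nat.log 2 (N ^ 2) with hpdef
  have hp1 : 2 ^ p ≤ N ^ 2 := Nat.pow_log_le_self 2 (by positivity)
  have hp2 : N ^ 2 ≤ 2 ^ (p + 1) := (Nat.lt_pow_succ_log_self one_lt_two _).le
  have hqN : q ≤ 2 ^ (p + 1) := by
    refine le_trans ?_ hp2
    have : (q : ℝ) ≤ (N : ℝ) ^ 2 := by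
      refine hq2.trans ?_
      rw [div_le_iff₀ (by positivity)]
      have : 1 < θ * N := by rwa [div_lt_iff₀ hN0] at hθN
      nlinarith
    exact_mod_cast this
  have hrK : r ≤ (2 ^ (p + 1)) ^ 2 ^ p := by
    have h1 : r ≤ 2 ^ (N + 1) := by
      have : r ≤ 2 * m := by exact_mod_cast hrm
      rw [pow_succ]; linarith
    have h2 : N + 1 ≤ 2 ^ p := by rw [pow_succ 2 p] at hp2; nlinarith
    calc r ≤ 2 ^ (N + 1) := h1
      _ ≤ 2 ^ 2 ^ p := Nat.pow_le_pow_right two_pos h2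
      _ ≤ (2 ^ (p + 1)) ^ 2 ^ p := Nat.pow_le_pow_left (Nat.le_self_pow (by simp) 2) _
  have hr200 : 200 ≤ Real.log r := by
    rw [Real.le_log_iff_exp_le hr0]
    refine le_trans ?_ hr1
    rw [le_div_iff₀ ht0]
    calc Real.exp 200 * t ≤ Real.exp 200 * Real.exp (-200) := by gcongr
      _ = 1 := by rw [← Real.exp_add]; norm_num
  have hrlam : Real.log r ≤ m / (k * q * r) := by
    have h1 : Real.log r ≤ 2 * Real.log m := by
      calc Real.log r ≤ Real.log ((m : ℝ) ^ 2) := Real.log_le_log hr0 (by nlinarith)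
        _ = 2 * Real.log m := by rw [Real.log_pow]; norm_num
    refine h1.trans ?_
    rw [le_div_iff₀ (by positivity)]
    have h2 : (r : ℝ) ≤ 2 / A := hr2.trans (by gcongr)
    calc 2 * Real.log m * (k * q * r)
        ≤ 2 * Real.log m * (L * (1 / (100 * θ ^ 2)) * (2 / A)) := by gcongr
      _ = m / 25 := by rw [hAdef]; field_simp; norm_num
      _ ≤ m := by linarith
  obtain ⟨hc1, hc2⟩ := log_card_bounds hN hk2 hp2 (by rw [pow_succ]; linarith)
  refine ⟨_, hc1, hc2, fun δ hδ => ?_⟩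
  refine exists_hard_class (q := q) (r := r) (K := 2 ^ p) (G := 5 * θ)
    (by exact_mod_cast hk0) (by exact_mod_cast hq0) p.succ_ne_zero hqN hrK
    (by rw [pow_succ]; linarith) (by linarith) ?_ hθ0.le (by linarith) rfl hr200 hrlam ?_
    (hδ.trans (margin_gap_lower_bound hm0 (by linarith) hθ0 ht0 ht1 hk1 hq1 hr1 hr2 rfl))
  · calc 4 * (5 * θ) ^ 2 * q ≤ 4 * (5 * θ) ^ 2 * (1 / (100 * θ ^ 2)) := by gcongr
      _ = 1 := by field_simp; norm_num
  · calc 1 / (r : ℝ) ≤ 1 / (1 / t) := one_div_le_one_div_of_le (by positivity) hr1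
      _ = t := one_div_one_div t
      _ ≤ τ := ht ▸ min_le_left _ _

/-- the improved margin-based generalization lower bound (Theorem 5.1). -/
theorem margin_generalization_lower_bound (a : ℝ) (ha : 0 < a) :
    ∃ (C β : ℝ) (N₀ : ℕ), 0 < C ∧ 0 < β ∧
      ∀ N : ℕ, N₀ ≤ N →
        ∀ θ : ℝ, 1 / (N : ℝ) < θ → θ < 1 / 40 →
          ∀ m : ℕ, ((1 / θ ^ 2) * Real.log N) ^ (1 + a) ≤ (m : ℝ) →
            (m : ℝ) ≤ 2 ^ ((N : ℝ) ^ β) →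
            ∀ τ : ℝ, Real.log N * Real.log m / (m * θ ^ 2) ≤ τ → τ ≤ 1 →
              ∃ (X : Type) (H : Finset (X → ℝ)) (D : PMF (X × ℝ)),
                (∀ h ∈ H, ∀ x, h x = 1 ∨ h x = -1) ∧
                (∀ p ∈ D.support, p.2 = 1 ∨ p.2 = -1) ∧
                (1 / C) * Real.log N ≤ Real.log H.card ∧
                Real.log H.card ≤ C * Real.log N ∧
                1 / 100 ≤ samplePr D m
                  {S : Fin m → X × ℝ |
                    ∃ α : (X → ℝ) → ℝ, (∀ h ∈ H, 0 ≤ α h) ∧ (∑ h ∈ H, α h = 1) ∧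
                      empLoss S (vote H α) θ ≤ τ ∧
                      empLoss S (vote H α) θ +
                          (1 / C) * (Real.log H.card * Real.log m / (m * θ ^ 2) +
                            Real.sqrt (τ * Real.log (1 / τ) *
                              Real.log H.card / (m * θ ^ 2))) ≤
                        pmfPr D {p : X × ℝ | p.2 * vote H α p.1 ≤ 0}} := by
  obtain ⟨M, hM⟩ := exists_forall_log_le_rpow ha
  set κ := a / (2 * (1 + a)) with hκ
  have hκ0 : 0 < κ := by positivity
  set R := 10 / Real.sqrt κ + Real.sqrt (10 * Real.exp 200) with hR
  set C := max 10 (2560 * R) with hC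
  have hC10 : 10 ≤ C := le_max_left _ _
  have hC0 : 0 < C := by linarith
  have hlogN := Real.tendsto_log_atTop.comp (tendsto_natCast_atTop_atTop (R := ℝ))
  obtain ⟨N₁, hN₁⟩ := Filter.eventually_atTop.1 (hlogN.eventually_ge_atTop (max M 1))
  refine ⟨C, 1, max 32 N₁, hC0, one_pos, ?_⟩
  intro N hN θ hθN hθ m hm hmN τ hτA hτ1
  have hN32 : 32 ≤ N := (le_max_left _ _).trans hN
  have hLM : max M 1 ≤ Real.log N := hN₁ N ((le_max_right _ _).trans hN)
  have hL1 : 1 ≤ Real.log N := (le_max_right _ _).trans hLM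
  have hθ0 : 0 < θ := lt_of_le_of_lt (by positivity) hθN
  have hB : 1600 * Real.log N ≤ 1 / θ ^ 2 * Real.log N := by
    gcongr
    rw [le_div_iff₀ (by positivity)]
    nlinarith
  have hBm : 1 / θ ^ 2 * Real.log N ≤ m :=
    (Real.self_le_rpow_of_one_le (by linarith) (by linarith)).trans hm
  have hMm : M ≤ m := by linarith [(le_max_left M 1).trans hLM]
  have hm1600 : (1600 : ℝ) ≤ m := by linarith
  have hlogm : 0 < Real.log m := Real.log_pos (by linarith)
  obtain ⟨hM1, hM2⟩ := hM m hMm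
  have hAm : Real.log N * Real.log m / (m * θ ^ 2) ≤ (m : ℝ) ^ (-κ) := by
    refine le_trans (le_of_eq ?_)
      (mul_log_div_le_rpow_neg ha (by positivity) (by linarith) hm hM1)
    field_simp
  have hA : Real.log N * Real.log m / (m * θ ^ 2) ≤ min τ (Real.exp (-200)) :=
    le_min hτA (hAm.trans hM2)
  have hτ0 : 0 < τ := lt_of_lt_of_le (by positivity) hτA
  have hm2N : m ≤ 2 ^ N := by
    rw [Real.rpow_one, Real.rpow_natCast] at hmN
    exact_mod_cast hmN
  obtain ⟨c, hc1, hc2, hclass⟩ := exists_hard_class_of_small hN32 hL1 hθN hθ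
    (by exact_mod_cast (by linarith : (3 : ℝ) ≤ m)) hm2N rfl hA
  obtain ⟨X, H, D, hH, hD, rfl, hS⟩ := hclass
    (1 / C * (Real.log c * Real.log m / (m * θ ^ 2) +
      Real.sqrt (τ * Real.log (1 / τ) * Real.log c / (m * θ ^ 2)))) <| by
    have h := complexity_terms_le_sqrt (by linarith) hθ0 (by linarith) hκ0 hτ0 rfl hA hAm
      (by linarith) hc2
    rw [one_div, inv_mul_le_iff₀ hC0]
    refine h.trans ?_
    calc _ = 2560 * R * (Real.sqrt (Real.log N / (m * θ ^ 2) * (min τ (Real.exp (-200)) *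
          Real.log (1 / min τ (Real.exp (-200))))) / 2560) := by ring
      _ ≤ _ := by gcongr; exact le_max_right _ _
  refine ⟨X, H, D, hH, hD, ?_, hc2.trans (by gcongr), hS⟩
  refine le_trans ?_ hc1
  rw [one_div, inv_mul_le_iff₀ hC0]
  nlinarith
end

section
/- Let N and r be positive integers and let d be an integer with 1 ≤ d ≤ r/2. Let 𝒯_d be the set of tuples T = (j_1,…,j_r) ∈ [N]^r such that exactly d distinct values occur among j_1,…,j_r and every value that occurs in T occurs at least twice. Then |𝒯_d| ≤ r^r · sqrt(2·e·π·r) · (N·e/r)^d. -/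
open Finset

/-- At most `N.choose d * d ^ r` maps `Fin r → Fin N` have an image of size `d`. -/
lemma card_filter_card_image_eq_le (N r d : ℕ) :
    (Finset.univ.filter (fun T : Fin r → Fin N =>
      (Finset.univ.filter (fun j : Fin N => ∃ i, T i = j)).card = d)).card ≤
      N.choose d * d ^ r := by
  have hsub : (Finset.univ.filter (fun T : Fin r → Fin N =>
      (Finset.univ.filter (fun j : Fin N => ∃ i, T i = j)).card = d)) ⊆
      ((Finset.univ : Finset (Fin N)).powersetCard d).biUnion
        (fun S => Fintype.piFinset fun _ : Fin r => S) := by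
    intro T hT
    rw [Finset.mem_filter] at hT
    rw [Finset.mem_biUnion]
    refine ⟨_, Finset.mem_powersetCard.2 ⟨Finset.subset_univ _, hT.2⟩, ?_⟩
    simp [Fintype.mem_piFinset]
  calc _ ≤ _ := Finset.card_le_card hsub
    _ ≤ ((Finset.univ : Finset (Fin N)).powersetCard d).card * d ^ r := by
      refine Finset.card_biUnion_le_card_mul _ _ _ fun S hS => ?_
      simp [Fintype.card_piFinset, (Finset.mem_powersetCard.1 hS).2]
    _ = N.choose d * d ^ r := by simp

/-- The bound `N.choose d * d ^ r ≤ r ^ r * (N * e / r) ^ d` for `d ≤ r`. -/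
lemma choose_mul_pow_le (N r d : ℕ) (hr : 0 < r) (hdr : d ≤ r) :
    (N.choose d : ℝ) * (d : ℝ) ^ r ≤ (r : ℝ) ^ r * ((N : ℝ) * Real.exp 1 / r) ^ d := by
  obtain ⟨k, rfl⟩ := Nat.exists_eq_add_of_le hdr
  have hr0 : ((d + k : ℕ) : ℝ) ≠ 0 := by exact_mod_cast hr.ne'
  have hfact : (d : ℝ) ^ d / (d.factorial : ℝ) ≤ Real.exp 1 ^ d := by
    simpa [← Real.exp_nat_mul] using
      Real.pow_div_factorial_le_exp (d : ℝ) (Nat.cast_nonneg d) d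
  have hle : (d : ℝ) ≤ ((d + k : ℕ) : ℝ) := by exact_mod_cast hdr
  calc (N.choose d : ℝ) * (d : ℝ) ^ (d + k)
      ≤ (N : ℝ) ^ d / (d.factorial : ℝ) * (d : ℝ) ^ (d + k) := by
        gcongr
        exact Nat.choose_le_pow_div d N
    _ = (N : ℝ) ^ d * ((d : ℝ) ^ d / (d.factorial : ℝ)) * (d : ℝ) ^ k := by ring
    _ ≤ (N : ℝ) ^ d * Real.exp 1 ^ d * ((d + k : ℕ) : ℝ) ^ k := by gcongr
    _ = ((d + k : ℕ) : ℝ) ^ (d + k) * ((N : ℝ) * Real.exp 1 / ((d + k : ℕ) : ℝ)) ^ d := by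
        rw [div_pow, mul_pow, pow_add]
        field_simp

/-- the number of `r`-tuples over `[N]` with exactly `d` distinct values,
each occurring at least twice, is at most `r^r·√(2eπr)·(Ne/r)^d`. -/
theorem count_tuples_repeated_values (N r d : ℕ) (hN : 0 < N) (hr : 0 < r)
    (hd1 : 1 ≤ d) (hd2 : (d : ℝ) ≤ (r : ℝ) / 2) :
    ((Finset.univ.filter (fun T : Fin r → Fin N =>
        (Finset.univ.filter (fun j : Fin N => ∃ i, T i = j)).card = d ∧
        ∀ j : Fin N, (∃ i, T i = j) →
          2 ≤ (Finset.univ.filter (fun i : Fin r => T i = j)).card)).card : ℝ) ≤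
      (r : ℝ) ^ r * Real.sqrt (2 * Real.exp 1 * Real.pi * r) *
        ((N : ℝ) * Real.exp 1 / r) ^ d := by
  have hr1 : (1 : ℝ) ≤ r := by exact_mod_cast hr
  have hdr : d ≤ r := by
    have : (d : ℝ) ≤ r := by linarith
    exact_mod_cast this
  have hsqrt : 1 ≤ Real.sqrt (2 * Real.exp 1 * Real.pi * r) := by
    have he : 1 ≤ 2 * Real.exp 1 := by linarith [Real.add_one_le_exp 1]
    have hpi : 1 ≤ Real.pi := by linarith [Real.pi_gt_three]
    exact Real.one_le_sqrt.2
      (one_le_mul_of_one_le_of_one_le (one_le_mul_of_one_le_of_one_le he hpi) hr1)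
  have hcard := (Finset.card_le_card (Finset.monotone_filter_right Finset.univ
    fun (T : Fin r → Fin N) _ (hT : (Finset.univ.filter (fun j : Fin N => ∃ i, T i = j)).card = d ∧
        ∀ j : Fin N, (∃ i, T i = j) →
          2 ≤ (Finset.univ.filter (fun i : Fin r => T i = j)).card) => hT.1)).trans
      (card_filter_card_image_eq_le N r d)
  calc _ ≤ ((N.choose d * d ^ r : ℕ) : ℝ) := Nat.cast_le.2 hcard
    _ = (N.choose d : ℝ) * (d : ℝ) ^ r := by push_cast; rfl
    _ ≤ (r : ℝ) ^ r * ((N : ℝ) * Real.exp 1 / r) ^ d := choose_mul_pow_le N r d hr hdr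
    _ ≤ (r : ℝ) ^ r * Real.sqrt (2 * Real.exp 1 * Real.pi * r) *
        ((N : ℝ) * Real.exp 1 / r) ^ d := by
      gcongr
      exact le_mul_of_one_le_right (by positivity) hsqrt
end

section
/- Let X be a nonnegative random variable, let d ≥ 1 and r be integers, and let c_1,…,c_d be integers with c_j ≥ 2 for all j and Σ_{j=1}^d c_j = r, where all moments E[X^{c_j}], E[X²] and E[X^{r−2d+2}] are finite. Then ∏_{j=1}^d E[X^{c_j}] ≤ (E[X²])^{d−1} · E[X^{r−2d+2}]. -/
open MeasureTheory Finset

section MomentBounds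

variable {Ω : Type*} [MeasurableSpace Ω] {μ : Measure Ω} {X : Ω → ℝ}

/-- For a nonnegative function, the set of integrable powers is order-connected. -/
theorem integrable_pow_of_le_of_le (hX : Measurable X) (hXnn : ∀ ω, 0 ≤ X ω) {k m n : ℕ}
    (hkm : k ≤ m) (hmn : m ≤ n) (hk : Integrable (fun ω => X ω ^ k) μ)
    (hn : Integrable (fun ω => X ω ^ n) μ) : Integrable (fun ω => X ω ^ m) μ := by
  refine (hk.add hn).mono' (hX.pow_const m).aestronglyMeasurable (.of_forall fun ω => ?_)
  rw [Real.norm_of_nonneg (pow_nonneg (hXnn ω) m), Pi.add_apply]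
  rcases le_total (X ω) 1 with h | h
  · exact (pow_le_pow_of_le_one (hXnn ω) h hkm).trans
      (le_add_of_nonneg_right (pow_nonneg (hXnn ω) n))
  · exact (pow_le_pow_right₀ h hmn).trans (le_add_of_nonneg_left (pow_nonneg (hXnn ω) k))

theorem sub_pow_mul_sub_pow_nonneg {x y : ℝ} (hx : 0 ≤ x) (hy : 0 ≤ y) (a b : ℕ) :
    0 ≤ (x ^ a - y ^ a) * (x ^ b - y ^ b) := by
  rcases le_total x y with h | h
  · exact mul_nonneg_of_nonpos_of_nonpos (sub_nonpos.2 (pow_le_pow_left₀ hx h a))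
      (sub_nonpos.2 (pow_le_pow_left₀ hx h b))
  · exact mul_nonneg (sub_nonneg.2 (pow_le_pow_left₀ hy h a))
      (sub_nonneg.2 (pow_le_pow_left₀ hy h b))

/-- Chebyshev's association inequality for powers of a nonnegative function. -/
theorem integral_pow_mul_integral_pow_le (hX : Measurable X) (hXnn : ∀ ω, 0 ≤ X ω) (k a b : ℕ)
    (h₀ : Integrable (fun ω => X ω ^ k) μ) (h : Integrable (fun ω => X ω ^ (a + b + k)) μ) :
    (∫ ω, X ω ^ (a + k) ∂μ) * ∫ ω, X ω ^ (b + k) ∂μ ≤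
      (∫ ω, X ω ^ k ∂μ) * ∫ ω, X ω ^ (a + b + k) ∂μ := by
  have ha : Integrable (fun ω => X ω ^ (a + k)) μ :=
    integrable_pow_of_le_of_le hX hXnn (by lia) (by lia) h₀ h
  have hb : Integrable (fun ω => X ω ^ (b + k)) μ :=
    integrable_pow_of_le_of_le hX hXnn (by lia) (by lia) h₀ h
  have integral_eq (p q r s : ℝ) :
      ∫ ω, (p * X ω ^ (a + b + k) - q * X ω ^ (b + k) - r * X ω ^ (a + k) + s * X ω ^ k) ∂μ =
        p * (∫ ω, X ω ^ (a + b + k) ∂μ) - q * (∫ ω, X ω ^ (b + k) ∂μ)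
          - r * (∫ ω, X ω ^ (a + k) ∂μ) + s * ∫ ω, X ω ^ k ∂μ := by
    have hpq : Integrable (fun ω => p * X ω ^ (a + b + k) - q * X ω ^ (b + k)) μ :=
      (h.const_mul p).sub (hb.const_mul q)
    have hpqr : Integrable
        (fun ω => p * X ω ^ (a + b + k) - q * X ω ^ (b + k) - r * X ω ^ (a + k)) μ :=
      hpq.sub (ha.const_mul r)
    rw [integral_add hpqr (h₀.const_mul s), integral_sub hpq (ha.const_mul r),
      integral_sub (h.const_mul p) (hb.const_mul q)]
    simp only [integral_const_mul]
  have inner_nonneg (y : ℝ) (hy : 0 ≤ y) :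
      0 ≤ 1 * (∫ ω, X ω ^ (a + b + k) ∂μ) - y ^ a * (∫ ω, X ω ^ (b + k) ∂μ)
        - y ^ b * (∫ ω, X ω ^ (a + k) ∂μ) + y ^ (a + b) * ∫ ω, X ω ^ k ∂μ := by
    rw [← integral_eq]
    refine integral_nonneg fun ω => ?_
    have := mul_nonneg (sub_pow_mul_sub_pow_nonneg (hXnn ω) hy a b) (pow_nonneg (hXnn ω) k)
    simp only [Pi.zero_apply]
    convert this using 1
    ring
  have outer_eq := integral_eq (∫ ω, X ω ^ k ∂μ) (∫ ω, X ω ^ (a + k) ∂μ)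
    (∫ ω, X ω ^ (b + k) ∂μ) (∫ ω, X ω ^ (a + b + k) ∂μ)
  have outer_nonneg := outer_eq ▸ integral_nonneg fun ω => by
    have := mul_nonneg (pow_nonneg (hXnn ω) k) (inner_nonneg (X ω) (hXnn ω))
    simp only [Pi.zero_apply]
    convert this using 1
    ring
  linarith

theorem prod_integral_pow_le {ι : Type*} (hX : Measurable X) (hXnn : ∀ ω, 0 ≤ X ω) (k : ℕ)
    (e : ι → ℕ) (h₀ : Integrable (fun ω => X ω ^ k) μ) {s : Finset ι} (hs : s.Nonempty)
    (h : Integrable (fun ω => X ω ^ (∑ j ∈ s, e j + k)) μ) :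
    ∏ j ∈ s, ∫ ω, X ω ^ (e j + k) ∂μ ≤
      (∫ ω, X ω ^ k ∂μ) ^ (#s - 1) * ∫ ω, X ω ^ (∑ j ∈ s, e j + k) ∂μ := by
  have moment_nonneg (n : ℕ) : 0 ≤ ∫ ω, X ω ^ n ∂μ :=
    integral_nonneg fun ω => pow_nonneg (hXnn ω) n
  induction hs using Finset.Nonempty.cons_induction with
  | singleton j => simp
  | cons j s hj hs ih =>
    rw [sum_cons] at h ⊢
    rw [prod_cons, card_cons, Nat.add_sub_cancel]
    have ih := ih (integrable_pow_of_le_of_le hX hXnn (by lia) (by lia) h₀ h)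
    calc
      _ ≤ (∫ ω, X ω ^ (e j + k) ∂μ) *
          ((∫ ω, X ω ^ k ∂μ) ^ (#s - 1) * ∫ ω, X ω ^ (∑ i ∈ s, e i + k) ∂μ) :=
        mul_le_mul_of_nonneg_left ih (moment_nonneg _)
      _ = (∫ ω, X ω ^ k ∂μ) ^ (#s - 1) *
          ((∫ ω, X ω ^ (e j + k) ∂μ) * ∫ ω, X ω ^ (∑ i ∈ s, e i + k) ∂μ) := by ring
      _ ≤ (∫ ω, X ω ^ k ∂μ) ^ (#s - 1) *
          ((∫ ω, X ω ^ k ∂μ) * ∫ ω, X ω ^ (e j + ∑ i ∈ s, e i + k) ∂μ) :=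
        mul_le_mul_of_nonneg_left (integral_pow_mul_integral_pow_le hX hXnn k _ _ h₀ h)
          (pow_nonneg (moment_nonneg k) _)
      _ = _ := by rw [← mul_assoc, pow_sub_one_mul hs.card_ne_zero]

end MomentBounds

/-- a consequence of Lyapunov's theorem (log-convexity of moments): for a
nonnegative random variable `X` and exponents `c_j ≥ 2` summing to `r`,
`∏_j E[X^{c_j}] ≤ E[X²]^{d-1} · E[X^{r-2d+2}]`. -/
theorem moment_product_bound {Ω : Type*} [MeasurableSpace Ω]
    (μ : Measure Ω) [IsProbabilityMeasure μ]
    (X : Ω → ℝ) (hX : Measurable X) (hXnn : ∀ ω, 0 ≤ X ω)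
    (d r : ℕ) (hd : 1 ≤ d)
    (c : Fin d → ℕ) (hc : ∀ j, 2 ≤ c j) (hsum : ∑ j, c j = r)
    (hint : ∀ j, Integrable (fun ω => X ω ^ c j) μ)
    (hint2 : Integrable (fun ω => X ω ^ 2) μ)
    (hint3 : Integrable (fun ω => X ω ^ (r - 2 * d + 2)) μ) :
    ∏ j, ∫ ω, X ω ^ c j ∂μ ≤
      (∫ ω, X ω ^ 2 ∂μ) ^ (d - 1) * ∫ ω, X ω ^ (r - 2 * d + 2) ∂μ := by
  have sum_sub : ∑ j, (c j - 2) = r - 2 * d := by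
    rw [sum_tsub_distrib _ fun j _ => hc j, hsum]
    simp [mul_comm]
  have : Nonempty (Fin d) := ⟨⟨0, hd⟩⟩
  have key := prod_integral_pow_le hX hXnn 2 (fun j => c j - 2) hint2 univ_nonempty
    (by rwa [sum_sub])
  simpa only [sum_sub, card_univ, Fintype.card_fin, Nat.sub_add_cancel (hc _)] using key
end
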